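/- Let Γ be a finite directed graph in which any two distinct cycles have no common vertex, and let F be a field. Let d₁ be the maximal length of a chain of cycles in Γ and d₂ the maximal length of a chain of cycles with an exit. Then the Gelfand–Kirillov dimension of the Leavitt path algebra L(Γ) equals max(2d₁ − 1, 2d₂): for any finite-dimensional generating subspace W of L(Γ), limsup_{n→∞} (log dim_F(W + W² + ⋯ + Wⁿ)) / (log n) = max(2d₁ − 1, 2d₂). -/

import Mathlib

open scoped BigOperators

section LeavittSetup

variable {V E : Type}

/-- Generators of the Leavitt path algebra of a graph: vertices, edges, and ghost (star) edges. -/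
inductive LGen (V E : Type) : Type
  | vert : V → LGen V E
  | edge : E → LGen V E
  | star : E → LGen V E

variable (F : Type) [Field F]

/-- The vertex generator inside the free algebra. -/
noncomputable def gvert (v : V) : FreeAlgebra F (LGen V E) := FreeAlgebra.ι F (LGen.vert v)

/-- The edge generator inside the free algebra. -/
noncomputable def gedge (e : E) : FreeAlgebra F (LGen V E) := FreeAlgebra.ι F (LGen.edge e)

/-- The ghost edge generator `e*` inside the free algebra. -/
noncomputable def gstar (e : E) : FreeAlgebra F (LGen V E) := FreeAlgebra.ι F (LGen.star e)

variable (s r : E → V)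

/-- The defining relations of the Leavitt path algebra of the graph `(V, E, s, r)`:
(1) `v * w = δ_{v,w} v`; (2) `s(e) e = e = e r(e)` and `r(e) e* = e* = e* s(e)`;
(3) `e* f = δ_{e,f} r(e)`; (4) `v = ∑_{s(e) = v} e e*` for every non-sink `v`
(the sum makes sense whenever `v` emits finitely many edges, in particular for a
row-finite graph). -/
inductive LeavittRel : FreeAlgebra F (LGen V E) → FreeAlgebra F (LGen V E) → Prop
  | vertSelf (v : V) : LeavittRel (gvert F v * gvert F v) (gvert F v)
  | vertNe {v w : V} (h : v ≠ w) : LeavittRel (gvert F v * gvert F w) 0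
  | edgeSource (e : E) : LeavittRel (gvert F (s e) * gedge F e) (gedge F e)
  | edgeRange (e : E) : LeavittRel (gedge F e * gvert F (r e)) (gedge F e)
  | starRange (e : E) : LeavittRel (gvert F (r e) * gstar F e) (gstar F e)
  | starSource (e : E) : LeavittRel (gstar F e * gvert F (s e)) (gstar F e)
  | starEdgeSelf (e : E) : LeavittRel (gstar F e * gedge F e) (gvert F (r e))
  | starEdgeNe {e f : E} (h : e ≠ f) : LeavittRel (gstar F e * gedge F f) 0
  | ck (v : V) (h : {e : E | s e = v}.Finite) (hne : ∃ e, s e = v) :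
      LeavittRel (gvert F v) (∑ e ∈ h.toFinset, gedge F e * gstar F e)

/-- The Leavitt path algebra `L(Γ)` of the graph `Γ = (V, E, s, r)` over the field `F`,
presented as the quotient of the free algebra on the generators by the Leavitt relations. -/
noncomputable abbrev LeavittPathAlgebra := RingQuot (LeavittRel F s r)

/-- The image of a vertex in the Leavitt path algebra. -/
noncomputable def lvert (v : V) : LeavittPathAlgebra F s r :=
  RingQuot.mkAlgHom F (LeavittRel F s r) (gvert F v)

/-- The image of an edge in the Leavitt path algebra. -/
noncomputable def ledge (e : E) : LeavittPathAlgebra F s r :=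
  RingQuot.mkAlgHom F (LeavittRel F s r) (gedge F e)

/-- The image of a ghost edge `e*` in the Leavitt path algebra. -/
noncomputable def lstar (e : E) : LeavittPathAlgebra F s r :=
  RingQuot.mkAlgHom F (LeavittRel F s r) (gstar F e)

/-- The element of the Leavitt path algebra given by a path `p = e₁ ⋯ eₙ` (a list of edges). -/
noncomputable def lpath (p : List E) : LeavittPathAlgebra F s r := (p.map (ledge F s r)).prod

/-- The element `p* = eₙ* ⋯ e₁*` of the Leavitt path algebra given by a path `p = e₁ ⋯ eₙ`. -/
noncomputable def lpathStar (p : List E) : LeavittPathAlgebra F s r :=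
  (p.reverse.map (lstar F s r)).prod

/-- A list of edges is a path when the range of each edge is the source of the next. -/
def IsPath (s r : E → V) (p : List E) : Prop := List.Chain' (fun e f => r e = s f) p

/-- A nonempty path starts at the source of its first edge. -/
def StartsAt (s : E → V) (p : List E) (v : V) : Prop := ∃ e, p.head? = some e ∧ s e = v

/-- A nonempty path ends at the range of its last edge. -/
def EndsAt (r : E → V) (p : List E) (v : V) : Prop := ∃ e, p.getLast? = some e ∧ r e = v

/-- A (nonempty) closed path: it starts and ends at the same vertex. -/
def IsClosedPath (s r : E → V) (p : List E) : Prop := ∃ v, StartsAt s p v ∧ EndsAt r p v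

/-- A cycle: a closed path whose source vertices are pairwise distinct.  A cycle is
identified with the subgraph it spans, i.e. with its set of edges `{e | e ∈ p}`. -/
def IsCycle (s r : E → V) (p : List E) : Prop :=
  IsPath s r p ∧ IsClosedPath s r p ∧ (p.map s).Nodup

/-- The vertex set `V(C)` of a cycle (the sources of its edges). -/
def cycleVerts (s : E → V) (c : List E) : Set V := {v | ∃ e ∈ c, s e = v}

/-- `C ⟹ C'`: some (possibly empty) path starts at a vertex of `C` and ends at a
vertex of `C'`. -/
def CycleConnects (s r : E → V) (c c' : List E) : Prop :=
  ∃ v w, v ∈ cycleVerts s c ∧ w ∈ cycleVerts s c' ∧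
    (v = w ∨ ∃ p, p ≠ [] ∧ IsPath s r p ∧ StartsAt s p v ∧ EndsAt r p w)

/-- A chain of cycles `C₁ ⟹ C₂ ⟹ ⋯ ⟹ C_k`: pairwise distinct cycles, each connected
to the next; its length is the number of cycles. -/
def IsChainOfCycles (s r : E → V) (cs : List (List E)) : Prop :=
  (∀ c ∈ cs, IsCycle s r c) ∧ List.Chain' (CycleConnects s r) cs ∧
    List.Pairwise (fun c c' => {e | e ∈ c} ≠ {e | e ∈ c'}) cs

/-- A cycle has an exit if some edge starts at a vertex of the cycle but is not an
edge of the cycle. -/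
def HasExit (s : E → V) (c : List E) : Prop := ∃ e, s e ∈ cycleVerts s c ∧ e ∉ c

/-- A chain of cycles with an exit: the last cycle of the chain has an exit. -/
def ChainWithExit (s r : E → V) (cs : List (List E)) : Prop :=
  IsChainOfCycles s r cs ∧ ∃ c, cs.getLast? = some c ∧ HasExit s c

/-- Any two distinct cycles of the graph have no common vertex: two cycles sharing a
vertex coincide (have the same edge set). -/
def SeparatedCycles (s r : E → V) : Prop :=
  ∀ c c', IsCycle s r c → IsCycle s r c' →
    (cycleVerts s c ∩ cycleVerts s c').Nonempty → {e | e ∈ c} = {e | e ∈ c'}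

/-- `W + W² + ⋯ + Wⁿ` for a subspace `W` of an `F`-algebra. -/
noncomputable def powsSum {A : Type} [Semiring A] [Algebra F A]
    (W : Submodule F A) (n : ℕ) : Submodule F A :=
  ∑ i ∈ Finset.Icc 1 n, W ^ i


end LeavittSetup


section Graph
variable {V E : Type} {s r : E → V}

/-- `Wk s r v p w`: the list `p` is a walk from `v` to `w`. -/
def Wk (s r : E → V) : V → List E → V → Prop
  | v, [], w => v = w
  | v, e :: p, w => s e = v ∧ Wk s r (r e) p w

theorem Wk.append {u v w : V} {p q : List E} (h : Wk s r u p v) (h' : Wk s r v q w) :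
    Wk s r u (p ++ q) w := by
  induction p generalizing u with
  | nil => cases h; exact h'
  | cons e p ih => exact ⟨h.1, ih h.2⟩

theorem Wk.split {u w : V} {p q : List E} (h : Wk s r u (p ++ q) w) :
    ∃ v, Wk s r u p v ∧ Wk s r v q w := by
  induction p generalizing u with
  | nil => exact ⟨u, rfl, h⟩
  | cons e p ih =>
    obtain ⟨v, h1, h2⟩ := ih h.2
    exact ⟨v, ⟨h.1, h1⟩, h2⟩

theorem Wk.unique {u v w : V} {p : List E} (h : Wk s r u p v) (h' : Wk s r u p w) : v = w := by
  induction p generalizing u with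
  | nil => exact h.symm.trans h'
  | cons e p ih => exact ih h.2 h'.2

/-- Reachability by a walk. -/
def Reach (s r : E → V) (v w : V) : Prop := ∃ p, Wk s r v p w

theorem Reach.refl (v : V) : Reach s r v v := ⟨[], rfl⟩

theorem Reach.trans {u v w : V} (h : Reach s r u v) (h' : Reach s r v w) : Reach s r u w := by
  obtain ⟨p, hp⟩ := h
  obtain ⟨q, hq⟩ := h'
  exact ⟨p ++ q, hp.append hq⟩

theorem Reach.edge (e : E) : Reach s r (s e) (r e) := ⟨[e], rfl, rfl⟩

/-- translating paths with endpoints to walks -/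
theorem wk_iff {p : List E} (hp : p ≠ []) {v w : V} :
    (IsPath s r p ∧ StartsAt s p v ∧ EndsAt r p w) ↔ Wk s r v p w := by
  induction p generalizing v with
  | nil => exact absurd rfl hp
  | cons e p ih =>
    cases p with
    | nil => simp [IsPath, StartsAt, EndsAt, Wk, List.Chain']
    | cons f q =>
      have ih := ih (by simp) (v := r e)
      simp only [IsPath, StartsAt, EndsAt, Wk] at ih ⊢
      simp only [List.Chain', List.isChain_cons_cons, List.head?_cons, List.getLast?_cons_cons,
        Option.some.injEq, exists_eq_left'] at ih ⊢
      rw [← ih]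
      tauto

theorem isCycle_iff {p : List E} :
    IsCycle s r p ↔ p ≠ [] ∧ (∃ v, Wk s r v p v) ∧ (p.map s).Nodup := by
  constructor
  · rintro ⟨h1, ⟨v, h2, h3⟩, h4⟩
    have hp : p ≠ [] := by
      rintro rfl
      obtain ⟨e, he, _⟩ := h2
      simp at he
    exact ⟨hp, ⟨v, (wk_iff hp).1 ⟨h1, h2, h3⟩⟩, h4⟩
  · rintro ⟨hp, ⟨v, hv⟩, h4⟩
    obtain ⟨h1, h2, h3⟩ := (wk_iff hp).2 hv
    exact ⟨h1, ⟨v, h2, h3⟩, h4⟩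

theorem IsCycle.rot {c : List E} (hc : IsCycle s r c) {u : V} (hu : u ∈ cycleVerts s c) :
    ∃ f c', (∀ e ∈ f :: c', e ∈ c) ∧ Wk s r u (f :: c') u := by
  obtain ⟨_, ⟨v, hv⟩, _⟩ := isCycle_iff.1 hc
  obtain ⟨f, hf, rfl⟩ := hu
  obtain ⟨a, b, rfl⟩ := List.append_of_mem hf
  obtain ⟨x, h1, h2⟩ := hv.split
  obtain ⟨rfl, h3⟩ := h2
  refine ⟨f, b ++ a, ?_, rfl, h3.append h1⟩
  intro e he
  simp at he ⊢
  tauto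

theorem IsCycle.nonempty {c : List E} (hc : IsCycle s r c) : ∃ u, u ∈ cycleVerts s c := by
  obtain ⟨hne, _, _⟩ := isCycle_iff.1 hc
  obtain ⟨e, he⟩ := List.exists_mem_of_ne_nil _ hne
  exact ⟨s e, e, he, rfl⟩

theorem IsCycle.reach {c : List E} (hc : IsCycle s r c) {u v : V} (hu : u ∈ cycleVerts s c)
    (hv : v ∈ cycleVerts s c) : Reach s r u v := by
  obtain ⟨_, ⟨w, hw⟩, _⟩ := isCycle_iff.1 hc
  obtain ⟨f, hf, rfl⟩ := hu
  obtain ⟨g, hg, rfl⟩ := hv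
  have h1 : Reach s r (s f) w := by
    obtain ⟨a, b, rfl⟩ := List.append_of_mem hf
    obtain ⟨x, h1, h2⟩ := hw.split
    obtain ⟨rfl, h3⟩ := h2
    exact ⟨f :: b, rfl, h3⟩
  have h2 : Reach s r w (s g) := by
    obtain ⟨a, b, rfl⟩ := List.append_of_mem hg
    obtain ⟨x, h1, h2⟩ := hw.split
    obtain ⟨rfl, h3⟩ := h2
    exact ⟨a, h1⟩
  exact h1.trans h2

theorem wk_map {u w : V} {p : List E} (h : Wk s r u p w) : p.map s ++ [w] = u :: p.map r := by
  induction p generalizing u with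
  | nil => cases h; rfl
  | cons e p ih =>
    obtain ⟨rfl, h2⟩ := h
    simp [ih h2]

theorem IsCycle.map_r {c : List E} (hc : IsCycle s r c) : (c.map r).Perm (c.map s) := by
  obtain ⟨_, ⟨w, hw⟩, _⟩ := isCycle_iff.1 hc
  have := wk_map hw
  have h2 : (c.map s ++ [w]).Perm (w :: c.map s) := List.perm_append_singleton _ _
  rw [this] at h2
  exact (List.perm_cons _).1 h2

theorem IsCycle.r_mem {c : List E} (hc : IsCycle s r c) {e : E} (he : e ∈ c) :
    r e ∈ cycleVerts s c := by
  have : r e ∈ c.map s := hc.map_r.mem_iff.1 (List.mem_map_of_mem he)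
  obtain ⟨f, hf, h⟩ := List.mem_map.1 this
  exact ⟨f, hf, h⟩

theorem IsCycle.s_inj {c : List E} (hc : IsCycle s r c) {e f : E} (he : e ∈ c) (hf : f ∈ c)
    (h : s e = s f) : e = f :=
  List.inj_on_of_nodup_map (isCycle_iff.1 hc).2.2 he hf h

theorem IsCycle.r_inj {c : List E} (hc : IsCycle s r c) {e f : E} (he : e ∈ c) (hf : f ∈ c)
    (h : r e = r f) : e = f :=
  List.inj_on_of_nodup_map (hc.map_r.nodup_iff.2 (isCycle_iff.1 hc).2.2) he hf h

/-- An edge that lies on some cycle. -/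
def CycEdge (s r : E → V) (e : E) : Prop := ∃ c, IsCycle s r c ∧ e ∈ c

theorem Wk.simple {u w : V} {p : List E} (h : Wk s r u p w) :
    ∃ p', Wk s r u p' w ∧ (p'.map s).Nodup ∧ w ∉ p'.map s := by
  induction p generalizing u with
  | nil => exact ⟨[], h, by simp, by simp⟩
  | cons e p ih =>
    obtain ⟨rfl, h2⟩ := h
    obtain ⟨q, hq, hn, hw⟩ := ih h2
    by_cases huw : s e = w
    · exact ⟨[], huw, by simp, by simp⟩
    by_cases hu : s e ∈ q.map s
    · obtain ⟨f, hf, hfe⟩ := List.mem_map.1 hu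
      obtain ⟨a, b, rfl⟩ := List.append_of_mem hf
      obtain ⟨x, h1, h2⟩ := hq.split
      obtain ⟨rfl, h3⟩ := h2
      refine ⟨f :: b, ⟨hfe, h3⟩, ?_, ?_⟩
      · rw [List.map_append] at hn
        exact hn.of_append_right
      · rw [List.map_append] at hw
        intro hh
        exact hw (List.mem_append_right _ hh)
    · exact ⟨e :: q, ⟨rfl, hq⟩, by simpa [hn] using hu, by
        simp only [List.map_cons, List.mem_cons, not_or]; exact ⟨fun h => huw h.symm, hw⟩⟩

theorem cycEdge_of_reach {e : E} (h : Reach s r (r e) (s e)) : CycEdge s r e := by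
  obtain ⟨p, hp⟩ := h
  obtain ⟨q, hq, hn, hw⟩ := hp.simple
  refine ⟨e :: q, isCycle_iff.2 ⟨by simp, ⟨s e, rfl, hq⟩, ?_⟩, by simp⟩
  simpa [hn] using hw

theorem cycleVerts_congr {c c' : List E} (h : {e | e ∈ c} = {e | e ∈ c'}) :
    cycleVerts s c = cycleVerts s c' := by
  have h : ∀ e, e ∈ c ↔ e ∈ c' := fun e => by simpa using Set.ext_iff.1 h e
  ext v
  simp [cycleVerts, h]

theorem hasExit_congr {c c' : List E} (h : {e | e ∈ c} = {e | e ∈ c'}) :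
    HasExit s c ↔ HasExit s c' := by
  have h' : ∀ e, e ∈ c ↔ e ∈ c' := fun e => by simpa using Set.ext_iff.1 h e
  simp [HasExit, cycleVerts_congr h, h']

theorem SeparatedCycles.s_inj (hsep : SeparatedCycles s r) {e f : E} (he : CycEdge s r e)
    (hf : CycEdge s r f) (h : s e = s f) : e = f := by
  obtain ⟨c, hc, hec⟩ := he
  obtain ⟨c', hc', hfc⟩ := hf
  have := hsep c c' hc hc' ⟨s e, ⟨e, hec, rfl⟩, ⟨f, hfc, h.symm⟩⟩
  have h' : ∀ e, e ∈ c ↔ e ∈ c' := fun e => by simpa using Set.ext_iff.1 this e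
  exact hc.s_inj hec ((h' f).2 hfc) h

theorem SeparatedCycles.mem_of_s (hsep : SeparatedCycles s r) {e : E} {c : List E}
    (hc : IsCycle s r c) (he : CycEdge s r e) (h : s e ∈ cycleVerts s c) : e ∈ c := by
  obtain ⟨f, hf, hfe⟩ := h
  rw [hsep.s_inj he ⟨c, hc, hf⟩ hfe.symm]
  exact hf

theorem SeparatedCycles.r_inj (hsep : SeparatedCycles s r) {e f : E} (he : CycEdge s r e)
    (hf : CycEdge s r f) (h : r e = r f) : e = f := by
  obtain ⟨c, hc, hec⟩ := he
  obtain ⟨c', hc', hfc⟩ := hf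
  have := hsep c c' hc hc' ⟨r e, hc.r_mem hec, h ▸ hc'.r_mem hfc⟩
  have h' : ∀ e, e ∈ c ↔ e ∈ c' := fun e => by simpa using Set.ext_iff.1 this e
  exact hc.r_inj hec ((h' f).2 hfc) h

/-- vertices on cycles without exit -/
def NEV (s r : E → V) : Set V := {v | ∃ c, IsCycle s r c ∧ ¬ HasExit s c ∧ v ∈ cycleVerts s c}

/-- edges on cycles without exit -/
def NEE (s r : E → V) : Set E := {e | s e ∈ NEV s r}

theorem nee_cyc {e : E} (h : e ∈ NEE s r) : CycEdge s r e := by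
  obtain ⟨c, hc, hx, hv⟩ := h
  refine ⟨c, hc, ?_⟩
  by_contra hn
  exact hx ⟨e, hv, hn⟩

theorem nee_r {e : E} (h : e ∈ NEE s r) : r e ∈ NEV s r := by
  obtain ⟨c, hc, hx, hv⟩ := h
  have : e ∈ c := by
    by_contra hn
    exact hx ⟨e, hv, hn⟩
  exact ⟨c, hc, hx, hc.r_mem this⟩

theorem hasExit_of_not_nee {e : E} {c : List E} (hc : IsCycle s r c) (he : e ∉ NEE s r)
    (hv : s e ∈ cycleVerts s c) : HasExit s c := by
  by_contra h
  exact he ⟨c, hc, h, hv⟩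

theorem connects_of_reach {c c' : List E} {v w : V} (hv : v ∈ cycleVerts s c)
    (hw : w ∈ cycleVerts s c') (h : Reach s r v w) : CycleConnects s r c c' := by
  obtain ⟨p, hp⟩ := h
  refine ⟨v, w, hv, hw, ?_⟩
  by_cases h : p = []
  · subst h; exact Or.inl hp
  · exact Or.inr ⟨p, h, (wk_iff h).2 hp⟩

theorem CycleConnects.reach {c c' : List E} (h : CycleConnects s r c c') :
    ∃ v w, v ∈ cycleVerts s c ∧ w ∈ cycleVerts s c' ∧ Reach s r v w := by
  obtain ⟨v, w, hv, hw, h⟩ := h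
  refine ⟨v, w, hv, hw, ?_⟩
  rcases h with rfl | ⟨p, h1, h2⟩
  · exact Reach.refl _
  · exact ⟨p, (wk_iff h1).1 h2⟩

theorem length_le_of_pairwise [Fintype E] {cs : List (List E)}
    (h : List.Pairwise (fun c c' => {e | e ∈ c} ≠ {e | e ∈ c'}) cs) :
    cs.length ≤ Nat.card (Set E) := by
  classical
  have : (cs.map (fun c => {e | e ∈ c})).Nodup := by
    rw [List.Nodup, List.pairwise_map]
    exact h
  have := this.length_le_card
  rw [List.length_map] at this
  rwa [Nat.card_eq_fintype_card]

/-- Chains of exit cycles reachable from `v` and from which `B` may be reached. -/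
def Ch (s r : E → V) (B : Set V) : V → List (List E) → Prop
  | v, [] => ∃ b ∈ B, Reach s r v b
  | v, c :: cs => IsCycle s r c ∧ HasExit s c ∧ (∃ u ∈ cycleVerts s c, Reach s r v u ∧
      Ch s r B u cs) ∧ ∀ c' ∈ cs, {e | e ∈ c} ≠ {e | e ∈ c'}

theorem Ch.mono {B : Set V} {u v : V} {cs : List (List E)} (h : Reach s r u v)
    (hc : Ch s r B v cs) : Ch s r B u cs := by
  cases cs with
  | nil => obtain ⟨b, hb, h'⟩ := hc; exact ⟨b, hb, h.trans h'⟩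
  | cons c cs =>
    obtain ⟨h1, h2, ⟨w, hw, h3, h4⟩, h5⟩ := hc
    exact ⟨h1, h2, ⟨w, hw, h.trans h3, h4⟩, h5⟩

theorem Ch.reach_mem {B : Set V} {v : V} {cs : List (List E)}
    (hc : Ch s r B v cs) {c : List E} (h : c ∈ cs) : ∃ u ∈ cycleVerts s c, Reach s r v u := by
  induction cs generalizing v with
  | nil => simp at h
  | cons c' cs ih =>
    obtain ⟨h1, h2, ⟨w, hw, h3, h4⟩, h5⟩ := hc
    rcases List.mem_cons.1 h with rfl | h
    · exact ⟨w, hw, h3⟩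
    · obtain ⟨u, hu, hr⟩ := ih h4 h
      exact ⟨u, hu, h3.trans hr⟩

theorem Ch.pairwise {B : Set V} {v : V} {cs : List (List E)} (hc : Ch s r B v cs) :
    List.Pairwise (fun c c' => {e | e ∈ c} ≠ {e | e ∈ c'}) cs := by
  induction cs generalizing v with
  | nil => simp
  | cons c' cs ih =>
    obtain ⟨h1, h2, ⟨w, hw, h3, h4⟩, h5⟩ := hc
    exact List.pairwise_cons.2 ⟨h5, ih h4⟩

theorem Ch.all {B : Set V} {v : V} {cs : List (List E)} (hc : Ch s r B v cs) :
    ∀ c ∈ cs, IsCycle s r c ∧ HasExit s c := by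
  induction cs generalizing v with
  | nil => simp
  | cons c' cs ih =>
    obtain ⟨h1, h2, ⟨w, hw, h3, h4⟩, h5⟩ := hc
    intro c hc
    rcases List.mem_cons.1 hc with rfl | h
    · exact ⟨h1, h2⟩
    · exact ih h4 c h

theorem Ch.chain {B : Set V} {v : V} {cs : List (List E)} (hc : Ch s r B v cs) :
    List.Chain' (CycleConnects s r) cs := by
  induction cs generalizing v with
  | nil => simp [List.Chain']
  | cons c' cs ih =>
    obtain ⟨h1, h2, ⟨w, hw, h3, h4⟩, h5⟩ := hc
    cases cs with
    | nil => simp [List.Chain']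
    | cons d ds =>
      refine List.isChain_cons_cons.2 ⟨?_, ih h4⟩
      obtain ⟨_, _, ⟨w', hw', h3', _⟩, _⟩ := h4
      exact connects_of_reach hw hw' h3'

theorem Ch.isChain {B : Set V} {v : V} {cs : List (List E)} (hc : Ch s r B v cs) :
    IsChainOfCycles s r cs := ⟨fun c h => (hc.all c h).1, hc.chain, hc.pairwise⟩

theorem Ch.last_reach {B : Set V} {v : V} {cs : List (List E)} (hc : Ch s r B v cs) {c : List E}
    (hl : cs.getLast? = some c) : ∃ u ∈ cycleVerts s c, ∃ b ∈ B, Reach s r u b := by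
  induction cs generalizing v with
  | nil => simp at hl
  | cons c' cs ih =>
    obtain ⟨h1, h2, ⟨w, hw, h3, h4⟩, h5⟩ := hc
    cases cs with
    | nil =>
      simp at hl
      subst hl
      exact ⟨w, hw, h4⟩
    | cons d ds =>
      rw [List.getLast?_cons_cons] at hl
      exact ih h4 hl

theorem Ch.withExit {B : Set V} {v : V} {cs : List (List E)} (hc : Ch s r B v cs) (h : cs ≠ []) :
    ChainWithExit s r cs :=
  ⟨hc.isChain, cs.getLast h, List.getLast?_eq_some_getLast h, (hc.all _ (List.getLast_mem h)).2⟩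

theorem Ch.extend {v : V} {cs : List (List E)} (hc : Ch s r (NEV s r) v cs) :
    ∃ c, IsChainOfCycles s r (cs ++ [c]) := by
  by_cases hcs : cs = []
  · subst hcs
    obtain ⟨b, ⟨c, hcc, _⟩, _⟩ := hc
    refine ⟨c, by simpa using hcc, by simp [List.Chain'], by simp⟩
  · obtain ⟨u, hu, b, ⟨c, hcc, hx, hb⟩, hr⟩ :=
      hc.last_reach (List.getLast?_eq_some_getLast hcs)
    refine ⟨c, ?_, ?_, ?_⟩
    · intro c' hc'
      rcases List.mem_append.1 hc' with h | h
      · exact (hc.all c' h).1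
      · simp at h; exact h ▸ hcc
    · refine List.IsChain.append hc.chain (by simp) ?_
      intro x hx y hy
      simp at hy
      subst hy
      rw [List.getLast?_eq_some_getLast hcs] at hx
      simp at hx
      subst hx
      exact connects_of_reach hu hb hr
    · refine List.pairwise_append.2 ⟨hc.pairwise, by simp, ?_⟩
      intro a ha b hb
      simp at hb
      subst hb
      intro h
      exact hx ((hasExit_congr h).1 (hc.all a ha).2)

/-- the potential function -/
noncomputable def pot (s r : E → V) (B : Set V) (v : V) : ℕ :=
  sSup {k | ∃ cs, Ch s r B v cs ∧ cs.length = k}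

theorem pot_bdd [Fintype E] (B : Set V) (v : V) :
    BddAbove {k | ∃ cs, Ch s r B v cs ∧ cs.length = k} := by
  refine ⟨Nat.card (Set E), ?_⟩
  rintro k ⟨cs, h, rfl⟩
  exact length_le_of_pairwise h.pairwise

theorem le_pot [Fintype E] {B : Set V} {v : V} {cs : List (List E)} (h : Ch s r B v cs) :
    cs.length ≤ pot s r B v := le_csSup (pot_bdd B v) ⟨cs, h, rfl⟩

theorem pot_attained [Fintype E] {B : Set V} {v b : V} (hb : b ∈ B) (h : Reach s r v b) :
    ∃ cs, Ch s r B v cs ∧ cs.length = pot s r B v :=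
  Nat.sSup_mem (s := {k | ∃ cs, Ch s r B v cs ∧ cs.length = k}) ⟨0, [], ⟨b, hb, h⟩, rfl⟩
    (pot_bdd B v)

/-- allowed edges -/
def Allow (s r : E → V) (B : Set V) : Set E := {e | e ∉ NEE s r ∧ ∃ b ∈ B, Reach s r (r e) b}

theorem pot_mono [Fintype E] {B : Set V} {e : E} (h : e ∈ Allow s r B) :
    pot s r B (r e) ≤ pot s r B (s e) := by
  obtain ⟨_, b, hb, hr⟩ := h
  obtain ⟨cs, hcs, hl⟩ := pot_attained hb hr
  rw [← hl]
  exact le_pot (hcs.mono (Reach.edge e))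

theorem pot_pos [Fintype E] {B : Set V} {e : E} (h : e ∈ Allow s r B) (hc : CycEdge s r e) :
    1 ≤ pot s r B (s e) := by
  obtain ⟨hn, b, hb, hr⟩ := h
  obtain ⟨c, hc, hec⟩ := hc
  exact le_pot (cs := [c]) ⟨hc, hasExit_of_not_nee hc hn ⟨e, hec, rfl⟩,
    ⟨s e, ⟨e, hec, rfl⟩, Reach.refl _, ⟨b, hb, (Reach.edge e).trans hr⟩⟩, by simp⟩

theorem pot_drop [Fintype E] {B : Set V} {e f : E} (h : e ∈ Allow s r B) (he : ¬ CycEdge s r e)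
    (hf : CycEdge s r f) (hs : s f = s e) :
    pot s r B (r e) + 1 ≤ pot s r B (s e) := by
  obtain ⟨hn, b, hb, hr⟩ := h
  obtain ⟨c, hc, hec⟩ := hf
  obtain ⟨cs, hcs, hl⟩ := pot_attained hb hr
  have hv : s e ∈ cycleVerts s c := ⟨f, hec, hs⟩
  rw [← hl]
  refine le_pot (cs := c :: cs) ⟨hc, hasExit_of_not_nee hc hn hv,
    ⟨s e, hv, Reach.refl _, hcs.mono (Reach.edge e)⟩, ?_⟩
  intro c' hc' heq
  obtain ⟨u, hu, hru⟩ := hcs.reach_mem hc'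
  rw [← cycleVerts_congr heq] at hu
  exact he (cycEdge_of_reach (hru.trans (hc.reach hu hv)))

theorem pot_univ_le [Fintype E] (v : V) (d₂ : ℕ)
    (hd₂ : d₂ = sSup {k : ℕ | ∃ cs, ChainWithExit s r cs ∧ cs.length = k}) :
    pot s r Set.univ v ≤ d₂ := by
  obtain ⟨cs, h, hl⟩ := pot_attained (s := s) (r := r) (B := Set.univ) (v := v) (b := v) trivial
    (Reach.refl _)
  rw [← hl, hd₂]
  by_cases hcs : cs = []
  · simp [hcs]
  refine le_csSup ⟨Nat.card (Set E), ?_⟩ ⟨cs, h.withExit hcs, rfl⟩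
  rintro k ⟨cs, h, rfl⟩
  exact length_le_of_pairwise h.1.2.2

theorem pot_nev_le [Fintype E] {v b : V} (d₁ : ℕ) (hb : b ∈ NEV s r) (hr : Reach s r v b)
    (hd₁ : d₁ = sSup {k : ℕ | ∃ cs, IsChainOfCycles s r cs ∧ cs.length = k}) :
    pot s r (NEV s r) v + 1 ≤ d₁ := by
  obtain ⟨cs, h, hl⟩ := pot_attained hb hr
  obtain ⟨c, hc⟩ := h.extend
  rw [← hl, hd₁]
  refine le_csSup ⟨Nat.card (Set E), ?_⟩ ⟨cs ++ [c], hc, by simp⟩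
  rintro k ⟨cs, h, rfl⟩
  exact length_le_of_pairwise h.2.2

end Graph


section Counting
variable {V E : Type} {s r : E → V}

open Classical in
/-- allowed walks of length at most `N` from a vertex -/
noncomputable def pths [Fintype E] (s r : E → V) (A : Set E) : ℕ → V → Finset (List E)
  | 0, _ => {[]}
  | N + 1, v => insert [] ((Finset.univ.filter (fun e => e ∈ A ∧ s e = v)).biUnion
      fun e => (pths s r A N (r e)).image (List.cons e))

theorem mem_pths [Fintype E] {A : Set E} {N : ℕ} {v w : V} {p : List E} (hp : Wk s r v p w)
    (hA : ∀ e ∈ p, e ∈ A) (hl : p.length ≤ N) : p ∈ pths s r A N v := by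
  induction N generalizing v p with
  | zero =>
    have : p = [] := List.length_eq_zero_iff.1 (by omega)
    simp [pths, this]
  | succ N ih =>
    cases p with
    | nil => simp [pths]
    | cons e p =>
      obtain ⟨rfl, h⟩ := hp
      have := ih h (fun f hf => hA f (by simp [hf])) (by simpa using hl)
      simp only [pths, Finset.mem_insert, Finset.mem_biUnion, Finset.mem_filter, Finset.mem_image]
      exact Or.inr ⟨e, ⟨Finset.mem_univ _, hA e (by simp), rfl⟩, p, this, rfl⟩

open Classical in
theorem card_pths_succ [Fintype E] (A : Set E) (N : ℕ) (v : V) :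
    (pths s r A (N + 1) v).card ≤
      1 + ∑ e ∈ Finset.univ.filter (fun e => e ∈ A ∧ s e = v), (pths s r A N (r e)).card := by
  rw [pths]
  refine (Finset.card_insert_le _ _).trans ?_
  rw [add_comm]
  refine Nat.add_le_add_left (Finset.card_biUnion_le.trans ?_) _
  exact Finset.sum_le_sum fun e _ => Finset.card_image_le

/-- number of reachable vertices -/
noncomputable def rk (s r : E → V) (v : V) : ℕ := {w | Reach s r v w}.ncard

theorem rk_le [Finite V] (e : E) : rk s r (r e) ≤ rk s r (s e) :=
  Set.ncard_le_ncard (fun _ h => (Reach.edge e).trans h) (Set.toFinite _)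

theorem rk_lt [Finite V] {e : E} (h : ¬ CycEdge s r e) : rk s r (r e) < rk s r (s e) := by
  refine Set.ncard_lt_ncard ⟨fun _ h => (Reach.edge e).trans h, fun hs => h ?_⟩ (Set.toFinite _)
  exact cycEdge_of_reach (hs (Reach.refl (s e)))

theorem card_pths_le [Fintype V] [Fintype E] (hsep : SeparatedCycles s r) (B : Set V) (m : ℕ) :
    ∃ C, ∀ v, rk s r v < m → ∀ N,
      (pths s r (Allow s r B) N v).card ≤ C * (N + 1) ^ pot s r B v := by
  classical
  induction m with
  | zero => exact ⟨0, fun v h => by omega⟩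
  | succ m ih =>
    obtain ⟨C, hC⟩ := ih
    set D := 1 + Fintype.card E * C with hD
    refine ⟨D, fun v hv N => ?_⟩
    induction N generalizing v with
    | zero => simp [pths, hD]
    | succ N ihN =>
      refine (card_pths_succ _ _ _).trans ?_
      set S := Finset.univ.filter (fun e => e ∈ Allow s r B ∧ s e = v) with hS
      by_cases hcyc : ∃ e ∈ S, CycEdge s r e
      · obtain ⟨e₀, he₀, hce⟩ := hcyc
        have h0 : e₀ ∈ Allow s r B ∧ s e₀ = v := by simpa [hS] using he₀
        have hpos : 1 ≤ pot s r B v := h0.2 ▸ pot_pos h0.1 hce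
        obtain ⟨k, hk⟩ : ∃ k, pot s r B v = k + 1 := ⟨pot s r B v - 1, by omega⟩
        rw [← Finset.add_sum_erase _ _ he₀]
        have h1 : (pths s r (Allow s r B) N (r e₀)).card ≤ D * (N + 1) ^ (k + 1) := by
          refine (ihN (r e₀) ?_).trans ?_
          · exact lt_of_le_of_lt (rk_le e₀) (h0.2.symm ▸ hv)
          · have := pot_mono h0.1
            rw [h0.2, hk] at this
            gcongr
            omega
        have h2 : ∑ e ∈ S.erase e₀, (pths s r (Allow s r B) N (r e)).card
            ≤ Fintype.card E * C * (N + 2) ^ k := by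
          have : ∀ e ∈ S.erase e₀, (pths s r (Allow s r B) N (r e)).card ≤ C * (N + 2) ^ k := by
            intro e he
            obtain ⟨hne, he⟩ := Finset.mem_erase.1 he
            have h : e ∈ Allow s r B ∧ s e = v := by simpa [hS] using he
            have hnc : ¬ CycEdge s r e := fun hc =>
              hne (hsep.s_inj hc hce (h.2.trans h0.2.symm))
            have hrk := rk_lt hnc
            rw [h.2] at hrk
            refine (hC (r e) (by omega) N).trans ?_
            have := pot_drop h.1 hnc hce (h0.2.trans h.2.symm)
            rw [h.2, hk] at this
            gcongr
            · omega
            · omega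
            · omega
          refine (Finset.sum_le_card_nsmul _ _ _ this).trans ?_
          rw [smul_eq_mul, mul_assoc]
          gcongr
          exact Finset.card_le_univ _
        have h3 : 1 ≤ (N + 2) ^ k := Nat.one_le_pow _ _ (by omega)
        have h4 : (N + 1) ^ k ≤ (N + 2) ^ k := Nat.pow_le_pow_left (by omega) _
        rw [hk]
        calc _ ≤ (N + 2) ^ k + (D * (N + 1) ^ (k + 1) + Fintype.card E * C * (N + 2) ^ k) := by
              omega
          _ = D * (N + 2) ^ k + D * ((N + 1) ^ k * (N + 1)) := by rw [hD]; ring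
          _ ≤ D * (N + 2) ^ k + D * ((N + 2) ^ k * (N + 1)) := by gcongr
          _ = D * (N + 1 + 1) ^ (k + 1) := by ring
      · push Not at hcyc
        have : ∀ e ∈ S, (pths s r (Allow s r B) N (r e)).card ≤ C * (N + 2) ^ pot s r B v := by
          intro e he
          have h : e ∈ Allow s r B ∧ s e = v := by simpa [hS] using he
          have hrk := rk_lt (hcyc e he)
          rw [h.2] at hrk
          refine (hC (r e) (by omega) N).trans ?_
          have := pot_mono h.1
          rw [h.2] at this
          gcongr
          · omega
          · omega
        have h2 := (Finset.sum_le_card_nsmul _ _ _ this)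
        have h3 : 1 ≤ (N + 2) ^ pot s r B v := Nat.one_le_pow _ _ (by omega)
        calc _ ≤ (N + 2) ^ pot s r B v + S.card • (C * (N + 2) ^ pot s r B v) := by omega
          _ ≤ (N + 2) ^ pot s r B v + Fintype.card E * (C * (N + 2) ^ pot s r B v) := by
            rw [smul_eq_mul]
            gcongr
            exact Finset.card_le_univ _
          _ = D * (N + 1 + 1) ^ pot s r B v := by rw [hD]; ring

open Classical in
/-- all allowed walks of length at most `N` -/
noncomputable def allPths [Fintype V] [Fintype E] (s r : E → V) (B : Set V) (N : ℕ) :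
    Finset (List E) := Finset.univ.biUnion (pths s r (Allow s r B) N)

theorem card_allPths_le [Fintype V] [Fintype E] (hsep : SeparatedCycles s r) (B : Set V) (d : ℕ)
    (hd : ∀ v, pot s r B v ≤ d) : ∃ C, ∀ N, (allPths s r B N).card ≤ C * (N + 1) ^ d := by
  classical
  obtain ⟨C, hC⟩ := card_pths_le hsep B (Fintype.card V + 1)
  refine ⟨Fintype.card V * C, fun N => ?_⟩
  refine Finset.card_biUnion_le.trans ?_
  refine (Finset.sum_le_card_nsmul _ _ (C * (N + 1) ^ d) ?_).trans ?_
  · intro v _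
    refine (hC v ?_ N).trans ?_
    · rw [Nat.lt_succ_iff, ← Nat.card_eq_fintype_card, ← Set.ncard_univ]
      exact Set.ncard_le_ncard (Set.subset_univ _) (Set.toFinite _)
    · gcongr
      · omega
      · exact hd v
  · simp [mul_assoc]

theorem mem_allPths [Fintype V] [Fintype E] {B : Set V} {N : ℕ} {v w : V} {p : List E}
    (hp : Wk s r v p w) (hA : ∀ e ∈ p, e ∉ NEE s r) (hw : w ∈ B)
    (hl : p.length ≤ N) : p ∈ allPths s r B N := by
  classical
  refine Finset.mem_biUnion.2 ⟨v, Finset.mem_univ _, mem_pths hp (fun e he => ⟨hA e he, w, hw, ?_⟩) hl⟩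
  obtain ⟨a, b, rfl⟩ := List.append_of_mem he
  obtain ⟨x, h1, h2⟩ := hp.split
  exact ⟨b, h2.2⟩

end Counting


section Rep
variable {V E : Type} (F : Type) [Field F] (s r : E → V)


theorem lvert_mul_self (v : V) : lvert F s r v * lvert F s r v = lvert F s r v := by
  rw [lvert, ← map_mul]; exact RingQuot.mkAlgHom_rel F (LeavittRel.vertSelf v)

theorem lvert_mul_ne {v w : V} (h : v ≠ w) : lvert F s r v * lvert F s r w = 0 := by
  rw [lvert, lvert, ← map_mul, ← map_zero (RingQuot.mkAlgHom F (LeavittRel F s r))]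
  exact RingQuot.mkAlgHom_rel F (LeavittRel.vertNe h)

theorem lvert_ledge (e : E) : lvert F s r (s e) * ledge F s r e = ledge F s r e := by
  rw [lvert, ledge, ← map_mul]; exact RingQuot.mkAlgHom_rel F (LeavittRel.edgeSource e)

theorem ledge_lvert (e : E) : ledge F s r e * lvert F s r (r e) = ledge F s r e := by
  rw [lvert, ledge, ← map_mul]; exact RingQuot.mkAlgHom_rel F (LeavittRel.edgeRange e)

theorem lvert_lstar (e : E) : lvert F s r (r e) * lstar F s r e = lstar F s r e := by
  rw [lvert, lstar, ← map_mul]; exact RingQuot.mkAlgHom_rel F (LeavittRel.starRange e)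

theorem lstar_lvert (e : E) : lstar F s r e * lvert F s r (s e) = lstar F s r e := by
  rw [lvert, lstar, ← map_mul]; exact RingQuot.mkAlgHom_rel F (LeavittRel.starSource e)

theorem lstar_ledge (e : E) : lstar F s r e * ledge F s r e = lvert F s r (r e) := by
  rw [lvert, lstar, ledge, ← map_mul]; exact RingQuot.mkAlgHom_rel F (LeavittRel.starEdgeSelf e)

theorem lstar_ledge_ne {e f : E} (h : e ≠ f) : lstar F s r e * ledge F s r f = 0 := by
  rw [lstar, ledge, ← map_mul, ← map_zero (RingQuot.mkAlgHom F (LeavittRel F s r))]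
  exact RingQuot.mkAlgHom_rel F (LeavittRel.starEdgeNe h)

theorem ledge_lstar_of_unique {e : E} (h : ∀ f, s f = s e → f = e) :
    ledge F s r e * lstar F s r e = lvert F s r (s e) := by
  have hs : {f : E | s f = s e} = {e} := by
    ext f
    simp only [Set.mem_ofPred_eq, Set.mem_singleton_iff]
    exact ⟨h f, fun h => h ▸ rfl⟩
  have hfin : {f : E | s f = s e}.Finite := hs ▸ Set.finite_singleton e
  have := RingQuot.mkAlgHom_rel F (LeavittRel.ck (F := F) (r := r) (s e) hfin ⟨e, rfl⟩)
  have ht : hfin.toFinset = {e} := by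
    ext f
    simp only [Set.Finite.mem_toFinset, hs, Set.mem_singleton_iff, Finset.mem_singleton]
  rw [ht, Finset.sum_singleton, map_mul] at this
  exact this.symm

/-- A self-similar labelling of `ℕ` by the out-edges of each vertex. -/
theorem exists_sigma [Fintype E] : ∃ σ : E → ℕ → ℕ,
    (∀ e f a b, s e = s f → σ e a = σ f b → e = f ∧ a = b) ∧
    (∀ e n, ∃ f a, s f = s e ∧ σ f a = n) := by
  classical
  have : ∀ v : V, (∃ e, s e = v) → Nonempty ({e // s e = v} × ℕ ≃ ℕ) := by
    rintro v ⟨e, he⟩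
    have : Nonempty {e // s e = v} := ⟨⟨e, he⟩⟩
    have : Countable {e // s e = v} := Finite.to_countable
    exact nonempty_equiv_of_countable
  choose σ hσ using fun v (h : ∃ e, s e = v) => (⟨(this v h).some, trivial⟩ :
    ∃ g : {e // s e = v} × ℕ ≃ ℕ, True)
  refine ⟨fun e a => σ (s e) ⟨e, rfl⟩ (⟨e, rfl⟩, a), ?_, ?_⟩
  · intro e f a b h hab
    have key : ∀ (v : V) (hv : ∃ e, s e = v) (he : s e = v),
        σ (s e) ⟨e, rfl⟩ (⟨e, rfl⟩, a) = σ v hv (⟨e, he⟩, a) := by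
      rintro v hv rfl; rfl
    have h1 := key (s f) ⟨f, rfl⟩ h
    dsimp only at hab
    rw [h1] at hab
    have := (σ (s f) ⟨f, rfl⟩).injective hab
    simp only [Prod.mk.injEq, Subtype.mk.injEq] at this
    exact this
  · intro e n
    obtain ⟨⟨⟨f, hf⟩, a⟩, h⟩ := (σ (s e) ⟨e, rfl⟩).surjective n
    refine ⟨f, a, hf, ?_⟩
    have key : ∀ (v : V) (hv : ∃ e, s e = v) (he : s f = v),
        σ (s f) ⟨f, rfl⟩ (⟨f, rfl⟩, a) = σ v hv (⟨f, he⟩, a) := by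
      rintro v hv rfl; rfl
    exact (key _ _ hf).trans h

/-- linear operator of a partial map on a basis -/
noncomputable def pop {X : Type} (g : X → Option X) : Module.End F (X →₀ F) :=
  Finsupp.linearCombination F (fun x => (g x).elim 0 (fun y => Finsupp.single y 1))

theorem pop_single {X : Type} (g : X → Option X) (x : X) :
    pop F g (Finsupp.single x 1) = (g x).elim 0 (fun y => Finsupp.single y 1) := by
  simp [pop]

theorem pop_mul_single {X : Type} (g h : X → Option X) (x : X) :
    (pop F g * pop F h) (Finsupp.single x 1) =
      ((h x).bind g).elim 0 (fun y => Finsupp.single y 1) := by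
  rw [Module.End.mul_apply, pop_single]
  cases h x with
  | none => simp
  | some y => simp [pop_single]

theorem end_ext {X : Type} {f g : Module.End F (X →₀ F)}
    (h : ∀ x, f (Finsupp.single x 1) = g (Finsupp.single x 1)) : f = g := by
  refine Finsupp.lhom_ext' fun x => LinearMap.ext_ring ?_
  simpa using h x

open Classical in
/-- partial action of generators -/
noncomputable def pact (σ : E → ℕ → ℕ) : LGen V E → V × ℕ × ℤ → Option (V × ℕ × ℤ)
  | .vert v, x => if x.1 = v then some x else none
  | .edge e, x => if x.1 = r e then some (s e, σ e x.2.1, x.2.2 + 1) else none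
  | .star e, x => if h : x.1 = s e ∧ ∃ a, σ e a = x.2.1 then
      some (r e, h.2.choose, x.2.2 - 1) else none

theorem exists_rep [Fintype E] : ∃ (φ : (LeavittPathAlgebra F s r) →ₐ[F] Module.End F ((V × ℕ × ℤ) →₀ F))
    (σ : E → ℕ → ℕ),
    (∀ v a n, φ (lvert F s r v) (Finsupp.single (v, a, n) 1) = Finsupp.single (v, a, n) 1) ∧
    (∀ e a n, φ (ledge F s r e) (Finsupp.single (r e, a, n) 1) =
      Finsupp.single (s e, σ e a, n + 1) 1) := by
  classical
  obtain ⟨σ, h1, h2⟩ := exists_sigma s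
  have hstar : ∀ e a n, pact s r σ (.star e) (s e, σ e a, n) = some (r e, a, n - 1) := by
    intro e a n
    have hx : ∃ b, σ e b = σ e a := ⟨a, rfl⟩
    have hb : hx.choose = a := (h1 _ _ _ _ rfl hx.choose_spec).2
    simp only [pact, true_and]
    rw [dif_pos hx]
    simp [hb]
  have hstar' : ∀ e f a n, f ≠ e → pact s r σ (.star e) (s f, σ f a, n) = none := by
    intro e f a n hne
    simp only [pact]
    rw [dif_neg]
    rintro ⟨h, b, hb⟩
    exact hne (h1 _ _ _ _ h hb.symm).1
  have hstar'' : ∀ e x, (∃ a, x = (s e, σ e a, x.2.2)) ∨ pact s r σ (.star e) x = none := by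
    rintro e ⟨v, m, n⟩
    by_cases h : v = s e ∧ ∃ a, σ e a = m
    · obtain ⟨rfl, a, rfl⟩ := h
      exact Or.inl ⟨a, rfl⟩
    · right
      simp only [pact]
      rw [dif_neg h]
  let f : LGen V E → Module.End F ((V × ℕ × ℤ) →₀ F) := fun g => pop F (pact s r σ g)
  let Φ := FreeAlgebra.lift F f
  have hΦ : ∀ g, Φ (FreeAlgebra.ι F g) = pop F (pact s r σ g) := fun g => by
    simp [Φ, f]
  have hrel : ∀ ⦃x y⦄, LeavittRel F s r x y → Φ x = Φ y := by
    intro x y hxy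
    cases hxy with
    | vertSelf v =>
      simp only [gvert, map_mul, hΦ]
      refine end_ext F fun x => ?_
      rw [pop_mul_single, pop_single]
      by_cases h : x.1 = v <;> simp [pact, h]
    | @vertNe v w h =>
      simp only [gvert, map_mul, hΦ, map_zero]
      refine end_ext F fun x => ?_
      rw [pop_mul_single]
      by_cases h' : x.1 = w
      · have : x.1 ≠ v := fun h'' => h (h''.symm.trans h')
        simp [pact, h', Ne.symm h]
      · simp [pact, h']
    | edgeSource e =>
      simp only [gvert, gedge, map_mul, hΦ]
      refine end_ext F fun x => ?_
      rw [pop_mul_single, pop_single]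
      by_cases h : x.1 = r e <;> simp [pact, h]
    | edgeRange e =>
      simp only [gvert, gedge, map_mul, hΦ]
      refine end_ext F fun x => ?_
      rw [pop_mul_single, pop_single]
      by_cases h : x.1 = r e <;> simp [pact, h]
    | starRange e =>
      simp only [gvert, gstar, map_mul, hΦ]
      refine end_ext F fun x => ?_
      rw [pop_mul_single, pop_single]
      rcases hstar'' e x with ⟨a, ha⟩ | h
      · rw [ha, hstar]; simp [pact]
      · rw [h]; simp
    | starSource e =>
      simp only [gvert, gstar, map_mul, hΦ]
      refine end_ext F fun x => ?_
      rw [pop_mul_single, pop_single]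
      by_cases h : x.1 = s e
      · simp [pact, h]
      · simp [pact, h]
    | starEdgeSelf e =>
      simp only [gvert, gedge, gstar, map_mul, hΦ]
      refine end_ext F fun x => ?_
      rw [pop_mul_single, pop_single]
      obtain ⟨v, a, n⟩ := x
      by_cases h : v = r e
      · subst h
        have : pact s r σ (.edge e) (r e, a, n) = some (s e, σ e a, n + 1) := by simp [pact]
        rw [this, Option.bind_some, hstar]
        simp [pact]
      · simp [pact, h]
    | @starEdgeNe e f h =>
      simp only [gedge, gstar, map_mul, hΦ, map_zero]
      refine end_ext F fun x => ?_
      rw [pop_mul_single]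
      obtain ⟨v, a, n⟩ := x
      by_cases h' : v = r f
      · subst h'
        have : pact s r σ (.edge f) (r f, a, n) = some (s f, σ f a, n + 1) := by simp [pact]
        rw [this, Option.bind_some, hstar' _ _ _ _ h.symm]
        simp
      · simp [pact, h']
    | ck v hfin hne =>
      simp only [gedge, gstar, gvert, map_sum, map_mul, hΦ]
      refine end_ext F fun x => ?_
      rw [pop_single, LinearMap.sum_apply]
      simp only [pop_mul_single]
      obtain ⟨w, m, n⟩ := x
      by_cases hw : w = v
      · obtain ⟨e₁, he₁⟩ := hne
        obtain ⟨e, a, he, ha⟩ := h2 e₁ m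
        subst hw
        obtain rfl : s e = w := he.trans he₁
        subst ha
        rw [Finset.sum_eq_single e]
        · rw [hstar]; simp [pact]
        · intro f hf hfe
          rw [hstar' _ _ _ _ hfe.symm]; simp
        · intro h
          simp at h
      · rw [Finset.sum_eq_zero]
        · simp [pact, hw]
        · intro e he
          have hev : s e = v := by simpa using he
          have : pact s r σ (.star e) (w, m, n) = none := by
            simp only [pact]
            rw [dif_neg]
            rintro ⟨h, _⟩
            exact hw (h.trans hev)
          rw [this]; simp
  refine ⟨RingQuot.liftAlgHom F ⟨Φ, hrel⟩, σ, ?_, ?_⟩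
  · intro v a n
    rw [lvert, RingQuot.liftAlgHom_mkAlgHom_apply, gvert, hΦ, pop_single]
    simp [pact]
  · intro v a n
    rw [ledge, RingQuot.liftAlgHom_mkAlgHom_apply, gedge, hΦ, pop_single]
    simp [pact]

theorem lpath_cons (e : E) (p : List E) :
    lpath F s r (e :: p) = ledge F s r e * lpath F s r p := by simp [lpath]

theorem lpath_append (p q : List E) :
    lpath F s r (p ++ q) = lpath F s r p * lpath F s r q := by simp [lpath]

theorem lpathStar_cons (e : E) (p : List E) :
    lpathStar F s r (e :: p) = lpathStar F s r p * lstar F s r e := by simp [lpathStar]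

theorem lpathStar_append (p q : List E) :
    lpathStar F s r (p ++ q) = lpathStar F s r q * lpathStar F s r p := by simp [lpathStar]

theorem lpath_nil : lpath F s r [] = 1 := by simp [lpath]
theorem lpathStar_nil : lpathStar F s r [] = 1 := by simp [lpathStar]

/-- powers of a closed walk are linearly independent -/
theorem indep_pow [Fintype E] {w : V} {c : List E} (hc : c ≠ []) (hw : Wk s r w c w) (a : ℕ → F)
    (N : ℕ) (h : ∑ i ∈ Finset.range N, a i • (lpath F s r c ^ i * lvert F s r w) = 0) :
    ∀ i < N, a i = 0 := by
  classical
  obtain ⟨φ, σ, h1, h2⟩ := exists_rep F s r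
  have hp : ∀ (p : List E) (u v : V), Wk s r u p v → ∀ a n, ∃ b,
      φ (lpath F s r p) (Finsupp.single (v, a, n) 1) = Finsupp.single (u, b, n + p.length) 1 := by
    intro p
    induction p with
    | nil =>
      intro u v huv a n
      cases huv
      exact ⟨a, by simp [lpath_nil]⟩
    | cons e p ih =>
      rintro u v ⟨rfl, huv⟩ a n
      obtain ⟨b, hb⟩ := ih _ _ huv a n
      refine ⟨σ e b, ?_⟩
      rw [lpath_cons, map_mul, Module.End.mul_apply, hb, h2]
      congr 3
      simp [add_assoc]
  have hpow : ∀ i : ℕ, ∃ b, φ (lpath F s r c ^ i * lvert F s r w) (Finsupp.single (w, 0, 0) 1)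
      = Finsupp.single (w, b, (i : ℤ) * c.length) 1 := by
    intro i
    rw [map_mul, Module.End.mul_apply, h1]
    induction i with
    | zero => exact ⟨0, by simp⟩
    | succ i ih =>
      obtain ⟨b, hb⟩ := ih
      obtain ⟨b', hb'⟩ := hp c w w hw b ((i : ℤ) * c.length)
      refine ⟨b', ?_⟩
      rw [pow_succ', map_mul, Module.End.mul_apply, hb, hb']
      congr 3
      push_cast; ring
  choose b hb using hpow
  have h3 := congrArg (fun x => φ x (Finsupp.single (w, 0, 0) 1)) h
  simp only [map_sum, map_smul, map_zero, LinearMap.sum_apply, LinearMap.smul_apply, hb,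
    LinearMap.zero_apply] at h3
  intro i hi
  have h4 := DFunLike.congr_fun h3 (w, b i, (i : ℤ) * c.length)
  have hlen : (c.length : ℤ) ≠ 0 := by
    simpa using hc
  rw [Finsupp.finsetSum_apply, Finset.sum_eq_single i] at h4
  · simpa using h4
  · intro j _ hj
    rw [Finsupp.smul_apply, Finsupp.single_apply, if_neg, smul_zero]
    intro hh
    simp only [Prod.mk.injEq, true_and] at hh
    exact hj (by exact_mod_cast mul_right_cancel₀ hlen hh.2)
  · intro h; exact absurd (Finset.mem_range.2 hi) h

theorem lvert_ne_zero [Fintype E] (w : V) : lvert F s r w ≠ 0 := by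
  obtain ⟨φ, σ, h1, h2⟩ := exists_rep F s r
  intro h
  have := h1 w 0 0
  rw [h] at this
  simp at this
  have := DFunLike.congr_fun this (w, 0, 0)
  simp at this

end Rep


section Pows
variable {F : Type} [Field F] {A : Type} [Ring A] [Algebra F A] (W : Submodule F A)

theorem le_powsSum {i n : ℕ} (h1 : 1 ≤ i) (h2 : i ≤ n) : W ^ i ≤ powsSum F W n := by
  rw [powsSum]
  exact Finset.single_le_sum (f := fun i => W ^ i) (fun i _ => bot_le)
    (Finset.mem_Icc.2 ⟨h1, h2⟩)

theorem powsSum_le {n : ℕ} {X : Submodule F A} (h : ∀ i, 1 ≤ i → i ≤ n → W ^ i ≤ X) :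
    powsSum F W n ≤ X := by
  rw [powsSum]
  refine Finset.sum_induction (fun i => W ^ i) (fun Y => Y ≤ X) ?_ bot_le ?_
  · intro a b ha hb
    exact sup_le ha hb
  · intro i hi
    exact h i (Finset.mem_Icc.1 hi).1 (Finset.mem_Icc.1 hi).2

theorem powsSum_mono {m n : ℕ} (h : m ≤ n) : powsSum F W m ≤ powsSum F W n :=
  powsSum_le W fun _ h1 h2 => le_powsSum W h1 (h2.trans h)

theorem powsSum_mul {a b : ℕ} {x y : A} (hx : x ∈ powsSum F W a) (hy : y ∈ powsSum F W b) :
    x * y ∈ powsSum F W (a + b) := by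
  have : powsSum F W a * powsSum F W b ≤ powsSum F W (a + b) := by
    rw [powsSum, powsSum, Finset.sum_mul_sum]
    refine Finset.sum_induction _ (fun Y => Y ≤ powsSum F W (a + b))
      (fun _ _ => sup_le) bot_le ?_
    intro i hi
    refine Finset.sum_induction _ (fun Y => Y ≤ powsSum F W (a + b))
      (fun _ _ => sup_le) bot_le ?_
    intro j hj
    rw [← pow_add]
    have := Finset.mem_Icc.1 hi
    have := Finset.mem_Icc.1 hj
    exact le_powsSum W (by omega) (by omega)
  exact this (Submodule.mul_mem_mul hx hy)

theorem powsSum_finite (hfd : FiniteDimensional F W) (n : ℕ) :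
    FiniteDimensional F (powsSum F W n) := by
  rw [powsSum]
  have hp : ∀ i, (W ^ i).FG := fun i => Submodule.FG.pow ((Submodule.fg_iff_finiteDimensional W).2 hfd) i
  refine (Submodule.fg_iff_finiteDimensional _).1 ?_
  refine Finset.sum_induction (fun i => W ^ i) (fun Y => Y.FG) ?_ Submodule.fg_bot ?_
  · intro a b ha hb
    exact ha.sup hb
  · intro i _
    exact hp i

end Pows

section Lower
variable {V E : Type} {s r : E → V}

/-- existence of large prefix-free families of walks -/
def LB (s r : E → V) (u w : V) (k : ℕ) : Prop := ∃ K : ℕ, ∀ N : ℕ, ∃ S : Finset (List E),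
  S.card = (N + 1) ^ k ∧ (∀ p ∈ S, Wk s r u p w ∧ p.length ≤ K * (N + 1)) ∧
    ∀ p ∈ S, ∀ q ∈ S, p <+: q → p = q

theorem LB_zero (u : V) : LB s r u u 0 :=
  ⟨0, fun N => ⟨{[]}, by simp, by simp [Wk], by simp⟩⟩

theorem pref_aux {f g : E} (hfg : f ≠ g) (c t p q : List E) (i j : ℕ)
    (h : (List.replicate i (f :: c)).flatten ++ (g :: t ++ p) <+:
      (List.replicate j (f :: c)).flatten ++ (g :: t ++ q)) : i = j ∧ p <+: q := by
  induction i generalizing j with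
  | zero =>
    cases j with
    | zero => simpa [List.prefix_append_right_inj] using h
    | succ j =>
      simp [List.replicate_succ] at h
      exact absurd h.1.symm hfg
  | succ i ih =>
    cases j with
    | zero =>
      simp [List.replicate_succ] at h
      exact absurd h.1 hfg
    | succ j =>
      rw [List.replicate_succ, List.replicate_succ, List.flatten_cons, List.flatten_cons,
        List.append_assoc, List.append_assoc, List.prefix_append_right_inj] at h
      obtain ⟨h1, h2⟩ := ih j h
      exact ⟨by omega, h2⟩

theorem Wk.pow {u : V} {c : List E} (h : Wk s r u c u) (i : ℕ) :
    Wk s r u (List.replicate i c).flatten u := by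
  induction i with
  | zero => rfl
  | succ i ih =>
    rw [List.replicate_succ, List.flatten_cons]
    exact h.append ih

theorem LB_step {u x w : V} {f g : E} {c t : List E} {k : ℕ} (hfg : f ≠ g)
    (hc : Wk s r u (f :: c) u) (ht : Wk s r u (g :: t) x) (h : LB s r x w k) :
    LB s r u w (k + 1) := by
  classical
  obtain ⟨K, hK⟩ := h
  refine ⟨(f :: c).length + (g :: t).length + K, fun N => ?_⟩
  obtain ⟨S, h1, h2, h3⟩ := hK N
  refine ⟨(Finset.range (N + 1) ×ˢ S).image
    (fun ip => (List.replicate ip.1 (f :: c)).flatten ++ (g :: t ++ ip.2)), ?_, ?_, ?_⟩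
  · rw [Finset.card_image_of_injOn, Finset.card_product, Finset.card_range, h1]
    · ring
    · rintro ⟨i, p⟩ hip ⟨j, q⟩ hjq heq
      simp only [Finset.coe_product, Set.mem_prod, Finset.mem_coe] at hip hjq
      dsimp only at heq
      obtain ⟨h4, h5⟩ := pref_aux hfg c t p q i j (heq ▸ List.prefix_rfl)
      have := h3 p hip.2 q hjq.2 h5
      simp [h4, this]
  · intro p hp
    obtain ⟨⟨i, q⟩, hiq, rfl⟩ := Finset.mem_image.1 hp
    obtain ⟨hi, hq⟩ := Finset.mem_product.1 hiq
    refine ⟨(hc.pow i).append (ht.append (h2 q hq).1), ?_⟩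
    have hl := (h2 q hq).2
    have hi : i ≤ N := by have := Finset.mem_range.1 hi; dsimp only at this; omega
    dsimp only at hl ⊢
    rw [List.length_append, List.length_append, List.length_flatten, List.map_replicate,
      List.sum_replicate, smul_eq_mul]
    have : i * (f :: c).length ≤ (N + 1) * (f :: c).length := by gcongr; omega
    nlinarith [Nat.zero_le (N * (g :: t).length)]
  · intro p hp q hq hpq
    obtain ⟨⟨i, p⟩, hip, rfl⟩ := Finset.mem_image.1 hp
    obtain ⟨⟨j, q⟩, hjq, rfl⟩ := Finset.mem_image.1 hq
    obtain ⟨h4, h5⟩ := pref_aux hfg c t p q i j hpq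
    have := h3 p (Finset.mem_product.1 hip).2 q (Finset.mem_product.1 hjq).2 h5
    simp [h4, this]

theorem LB_cycle {u x w : V} {g : E} {c t : List E} {k : ℕ} (hc : IsCycle s r c)
    (hu : u ∈ cycleVerts s c) (hg : g ∉ c)
    (ht : Wk s r u (g :: t) x) (h : LB s r x w k) : LB s r u w (k + 1) := by
  obtain ⟨f, c', hf, hw⟩ := hc.rot hu
  refine LB_step ?_ hw ht h
  rintro rfl
  exact hg (hf f (by simp))

theorem exists_leave {c p : List E} {v x : V} (hc : IsCycle s r c) (hv : v ∈ cycleVerts s c)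
    (hx : x ∉ cycleVerts s c) (hp : Wk s r v p x) :
    ∃ u g t, u ∈ cycleVerts s c ∧ g ∉ c ∧ Wk s r u (g :: t) x := by
  induction p generalizing v with
  | nil => cases hp; exact absurd hv hx
  | cons f p ih =>
    by_cases hf : f ∈ c
    · exact ih (hc.r_mem hf) hp.2
    · exact ⟨v, f, p, hv, hf, hp⟩

theorem LB_chain (hsep : SeparatedCycles s r) {c : List E} {u w : V} {k : ℕ}
    (hu : u ∈ cycleVerts s c) (h : LB s r u w k) (cs : List (List E))
    (hcs : IsChainOfCycles s r (cs ++ [c])) :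
    ∃ d u', (cs ++ [c]).head? = some d ∧ u' ∈ cycleVerts s d ∧ LB s r u' w (k + cs.length) := by
  induction cs with
  | nil => exact ⟨c, u, rfl, hu, h⟩
  | cons c' cs ih =>
    obtain ⟨h1, h2, h3⟩ := hcs
    obtain ⟨d, u', hd, hu', hlb⟩ := ih ⟨fun x hx => h1 x (by simp at hx ⊢; tauto),
      h2.tail, h3.tail⟩
    have hne : cs ++ [c] ≠ [] := by simp
    obtain ⟨ds, hds⟩ : ∃ ds, cs ++ [c] = d :: ds := by
      cases hq : cs ++ [c] with
      | nil => exact absurd hq hne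
      | cons a b => rw [hq] at hd; simp at hd; exact ⟨b, by rw [hd]⟩
    rw [List.cons_append] at h1 h2 h3
    rw [hds] at h1 h2 h3
    have hc' := h1 c' (by simp)
    have hdc := h1 d (by simp)
    have hcon : CycleConnects s r c' d := (List.isChain_cons_cons.1 h2).1
    have hdist := (List.pairwise_cons.1 h3).1 d (by simp)
    obtain ⟨v, x, hv, hx, hr⟩ := hcon.reach
    obtain ⟨p, hp⟩ := hr.trans (hdc.reach hx hu')
    have hx : u' ∉ cycleVerts s c' := fun hh => hdist (hsep c' d hc' hdc ⟨u', hh, hu'⟩)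
    obtain ⟨u'', g, t, h5, h6, h7⟩ := exists_leave hc' hv hx hp
    exact ⟨c', u'', rfl, h5, LB_cycle hc' h5 h6 h7 hlb⟩

variable (F : Type) [Field F]

theorem lvert_lpath {u w : V} {p : List E} (h : Wk s r u p w) :
    lvert F s r u * (lpath F s r p * lvert F s r w) = lpath F s r p * lvert F s r w := by
  cases p with
  | nil => cases h; simp [lpath_nil, lvert_mul_self]
  | cons e p =>
    obtain ⟨rfl, h⟩ := h
    rw [lpath_cons, ← mul_assoc, ← mul_assoc, lvert_ledge]

theorem star_path {u w : V} {p : List E} (h : Wk s r u p w) :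
    lpathStar F s r p * (lpath F s r p * lvert F s r w) = lvert F s r w := by
  induction p generalizing u with
  | nil => simp [lpath_nil, lpathStar_nil]
  | cons e p ih =>
    obtain ⟨rfl, h⟩ := h
    calc _ = lpathStar F s r p * ((lstar F s r e * ledge F s r e) *
          (lpath F s r p * lvert F s r w)) := by
          rw [lpath_cons, lpathStar_cons]; simp only [mul_assoc]
      _ = _ := by rw [lstar_ledge, lvert_lpath F h, ih h]

theorem star_path_ne {u w w' : V} {p q : List E} (h : Wk s r u p w) (h' : Wk s r u q w')
    (hpq : ¬ p <+: q) (hqp : ¬ q <+: p) :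
    lpathStar F s r p * (lpath F s r q * lvert F s r w') = 0 := by
  induction p generalizing u q with
  | nil => exact absurd (by simp) hpq
  | cons e p ih =>
    cases q with
    | nil => exact absurd (by simp) hqp
    | cons f q =>
      have : lpathStar F s r (e :: p) * (lpath F s r (f :: q) * lvert F s r w') =
          lpathStar F s r p * ((lstar F s r e * ledge F s r f) *
          (lpath F s r q * lvert F s r w')) := by
        rw [lpath_cons, lpathStar_cons]; simp only [mul_assoc]
      rw [this]
      by_cases hef : e = f
      · subst hef
        rw [lstar_ledge, lvert_lpath F h'.2]
        refine ih h.2 h'.2 ?_ ?_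
        · simpa using hpq
        · simpa using hqp
      · rw [lstar_ledge_ne F s r hef]; simp

theorem lpath_pow (c : List E) (i : ℕ) :
    lpath F s r c ^ i = lpath F s r (List.replicate i c).flatten := by
  induction i with
  | zero => simp [lpath_nil]
  | succ i ih => rw [List.replicate_succ, List.flatten_cons, lpath_append, ← ih, pow_succ']

theorem indep_family {u w : V} {c : List E} (hw : Wk s r w c w) {M : ℕ}
    (hz : ∀ a : ℕ → F, ∑ i ∈ Finset.range M, a i • (lpath F s r c ^ i * lvert F s r w) = 0 →
      ∀ i < M, a i = 0) (S : Finset (List E)) (hS : ∀ p ∈ S, Wk s r u p w)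
    (hpre : ∀ p ∈ S, ∀ q ∈ S, p <+: q → p = q) :
    LinearIndependent F (fun x : S × S × Fin M =>
      lpath F s r x.1 * (lpath F s r c ^ (x.2.2 : ℕ) * lvert F s r w) *
        lpathStar F s r x.2.1) := by
  classical
  rw [Fintype.linearIndependent_iff]
  rintro a ha ⟨p₀, q₀, i₀⟩
  have hort : ∀ p q : S, lpathStar F s r p * (lpath F s r q * lvert F s r w) =
      if p = q then lvert F s r w else 0 := by
    intro p q
    split_ifs with h
    · subst h; exact star_path F (hS p p.2)
    · refine star_path_ne F (hS p p.2) (hS q q.2) ?_ ?_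
      · intro h'; exact h (Subtype.ext (hpre p p.2 q q.2 h'))
      · intro h'; exact h (Subtype.ext (hpre q q.2 p p.2 h').symm)
  have hmid : ∀ i : ℕ, lvert F s r w * (lpath F s r c ^ i * lvert F s r w) =
      lpath F s r c ^ i * lvert F s r w := fun i => by
    rw [lpath_pow]; exact lvert_lpath F (hw.pow i)
  have hsand : ∀ (p q : S) (i : ℕ), lpathStar F s r p₀ * (lpath F s r p *
      (lpath F s r c ^ i * lvert F s r w) * lpathStar F s r q) * (lpath F s r q₀ * lvert F s r w) =
      if p₀ = p ∧ q = q₀ then lpath F s r c ^ i * lvert F s r w else 0 := by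
    intro p q i
    calc _ = (lpathStar F s r p₀ * (lpath F s r p * lvert F s r w)) *
          (lpath F s r c ^ i * lvert F s r w) *
          (lpathStar F s r q * (lpath F s r q₀ * lvert F s r w)) := by
          conv_lhs => rw [← hmid i]
          simp only [mul_assoc]
      _ = _ := by
          rw [hort, hort]
          by_cases h1 : p₀ = p
          · by_cases h2 : q = q₀
            · simp only [h1, h2, if_true, and_self]
              rw [hmid, mul_assoc, lvert_mul_self]
            · simp [h2]
          · simp [h1]
  have h2 := congrArg (fun x => lpathStar F s r p₀ * x * (lpath F s r q₀ * lvert F s r w)) ha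
  simp only [Finset.mul_sum, Finset.sum_mul, mul_smul_comm, smul_mul_assoc, hsand, mul_zero,
    zero_mul] at h2
  rw [Fintype.sum_prod_type, Finset.sum_eq_single p₀, Fintype.sum_prod_type,
    Finset.sum_eq_single q₀] at h2
  · simp only [and_self, if_true] at h2
    have h3 := hz (fun i => if h : i < M then a (p₀, q₀, ⟨i, h⟩) else 0) (by
      rw [Finset.sum_range, ← h2]
      refine Finset.sum_congr rfl fun i _ => ?_
      simp) i₀ i₀.2
    simpa using h3
  · intro q _ hq
    simp [hq]
  · simp
  · intro p _ hp
    simp [hp.symm]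
  · simp

theorem lower_core [Fintype V] [Fintype E] {u w : V} {c : List E} {k ε : ℕ} (hw : Wk s r w c w)
    (hz : ∀ (N : ℕ) (a : ℕ → F), ∑ i ∈ Finset.range ((N + 1) ^ ε),
      a i • (lpath F s r c ^ i * lvert F s r w) = 0 → ∀ i < (N + 1) ^ ε, a i = 0)
    (hε : ε ≤ 1) (hLB : LB s r u w k)
    (W : Submodule F (LeavittPathAlgebra F s r)) (hfd : FiniteDimensional F W)
    (hgen : ∀ x : LeavittPathAlgebra F s r, ∃ n : ℕ, x ∈ powsSum F W n) :
    ∃ M : ℕ, ∀ N : ℕ, (N + 1) ^ (2 * k + ε) ≤ Module.finrank F (powsSum F W (M * (N + 1))) := by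
  classical
  obtain ⟨m, hm1, hmv, hme, hms⟩ : ∃ m, 1 ∈ powsSum F W m ∧ (∀ v, lvert F s r v ∈ powsSum F W m) ∧
      (∀ e, ledge F s r e ∈ powsSum F W m) ∧ (∀ e, lstar F s r e ∈ powsSum F W m) := by
    choose g hg using hgen
    refine ⟨g 1 + ∑ v, g (lvert F s r v) + ∑ e, g (ledge F s r e) + ∑ e, g (lstar F s r e),
      ?_, ?_, ?_, ?_⟩
    · exact powsSum_mono W (by omega) (hg 1)
    · intro v
      have := Finset.single_le_sum (f := fun v => g (lvert F s r v)) (fun _ _ => Nat.zero_le _)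
        (Finset.mem_univ v)
      exact powsSum_mono W (by omega) (hg _)
    · intro v
      have := Finset.single_le_sum (f := fun v => g (ledge F s r v)) (fun _ _ => Nat.zero_le _)
        (Finset.mem_univ v)
      exact powsSum_mono W (by omega) (hg _)
    · intro v
      have := Finset.single_le_sum (f := fun v => g (lstar F s r v)) (fun _ _ => Nat.zero_le _)
        (Finset.mem_univ v)
      exact powsSum_mono W (by omega) (hg _)
  have hpath : ∀ p : List E, lpath F s r p ∈ powsSum F W (m * (p.length + 1)) := by
    intro p
    induction p with
    | nil => simpa [lpath_nil] using hm1
    | cons e p ih =>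
      rw [lpath_cons]
      exact powsSum_mono W (by simp; ring_nf; omega) (powsSum_mul W (hme e) ih)
  have hpathS : ∀ p : List E, lpathStar F s r p ∈ powsSum F W (m * (p.length + 1)) := by
    intro p
    induction p with
    | nil => simpa [lpathStar_nil] using hm1
    | cons e p ih =>
      rw [lpathStar_cons]
      exact powsSum_mono W (by simp; ring_nf; omega) (powsSum_mul W ih (hms e))
  obtain ⟨K, hK⟩ := hLB
  refine ⟨m * (2 * K + c.length + 4), fun N => ?_⟩
  obtain ⟨S, h1, h2, h3⟩ := hK N
  have hind := indep_family F hw (hz N) S (fun p hp => (h2 p hp).1) h3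
  have hcard := finrank_span_eq_card hind
  have hle : Submodule.span F (Set.range (fun x : S × S × Fin ((N + 1) ^ ε) =>
      lpath F s r x.1 * (lpath F s r c ^ (x.2.2 : ℕ) * lvert F s r w) *
        lpathStar F s r x.2.1)) ≤ powsSum F W (m * (2 * K + c.length + 4) * (N + 1)) := by
    rw [Submodule.span_le]
    rintro _ ⟨⟨p, q, i⟩, rfl⟩
    dsimp only
    have hi : (i : ℕ) ≤ N := by
      have hi := i.2
      have : (N + 1) ^ ε ≤ (N + 1) ^ 1 := Nat.pow_le_pow_right (by omega) hε
      rw [pow_one] at this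
      omega
    rw [lpath_pow]
    have hp := (h2 p p.2).2
    have hq := (h2 q q.2).2
    refine powsSum_mono W ?_ (powsSum_mul W (powsSum_mul W (hpath p) (powsSum_mul W
      (hpath _) (hmv w))) (hpathS q))
    rw [List.length_flatten, List.map_replicate, List.sum_replicate, smul_eq_mul]
    have h4 : (i : ℕ) * c.length ≤ N * c.length := by gcongr
    have : ((p : List E).length + 1) + (((i : ℕ) * c.length + 1) + 1) + ((q : List E).length + 1)
      ≤ (2 * K + c.length + 4) * (N + 1) := by nlinarith
    calc _ = m * (((p : List E).length + 1) + (((i : ℕ) * c.length + 1) + 1) +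
          ((q : List E).length + 1)) := by ring
      _ ≤ m * ((2 * K + c.length + 4) * (N + 1)) := by gcongr
      _ = _ := by ring
  have := powsSum_finite W hfd (m * (2 * K + c.length + 4) * (N + 1))
  have hfin := Submodule.finrank_mono hle
  rw [hcard] at hfin
  refine le_trans (le_of_eq ?_) hfin
  simp [h1]
  ring

theorem lower_one [Fintype V] [Fintype E] (hsep : SeparatedCycles s r) (d₁ : ℕ) (h0 : 0 < d₁)
    (hd₁ : d₁ = sSup {k : ℕ | ∃ cs, IsChainOfCycles s r cs ∧ cs.length = k})
    (W : Submodule F (LeavittPathAlgebra F s r)) (hfd : FiniteDimensional F W)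
    (hgen : ∀ x : LeavittPathAlgebra F s r, ∃ n : ℕ, x ∈ powsSum F W n) :
    ∃ M : ℕ, ∀ N : ℕ, (N + 1) ^ (2 * d₁ - 1) ≤
      Module.finrank F (powsSum F W (M * (N + 1))) := by
  have hmem : d₁ ∈ {k : ℕ | ∃ cs, IsChainOfCycles s r cs ∧ cs.length = k} := by
    rw [hd₁]
    refine Nat.sSup_mem ⟨0, [], ⟨by simp, List.isChain_nil, by simp⟩, rfl⟩
      ⟨Nat.card (Set E), ?_⟩
    rintro k ⟨cs, h, rfl⟩
    exact length_le_of_pairwise h.2.2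
  obtain ⟨cs, hcs, hl⟩ := hmem
  rcases List.eq_nil_or_concat cs with rfl | ⟨ds, c, rfl⟩
  · simp at hl; omega
  rw [List.concat_eq_append] at hcs hl
  have hcyc : IsCycle s r c := hcs.1 c (by simp)
  obtain ⟨u, hu⟩ := hcyc.nonempty
  obtain ⟨d, u', _, _, hLB⟩ := LB_chain hsep hu (LB_zero u) ds hcs
  obtain ⟨f, c', _, hw⟩ := hcyc.rot hu
  have := lower_core F (ε := 1) hw (fun N a => indep_pow F s r (by simp) hw a _) le_rfl hLB W
    hfd hgen
  have hh : 2 * (0 + ds.length) + 1 = 2 * d₁ - 1 := by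
    simp at hl; omega
  rwa [hh] at this

theorem lower_two [Fintype V] [Fintype E] (hsep : SeparatedCycles s r) (d₂ : ℕ) (h0 : 0 < d₂)
    (hd₂ : d₂ = sSup {k : ℕ | ∃ cs, ChainWithExit s r cs ∧ cs.length = k})
    (W : Submodule F (LeavittPathAlgebra F s r)) (hfd : FiniteDimensional F W)
    (hgen : ∀ x : LeavittPathAlgebra F s r, ∃ n : ℕ, x ∈ powsSum F W n) :
    ∃ M : ℕ, ∀ N : ℕ, (N + 1) ^ (2 * d₂) ≤
      Module.finrank F (powsSum F W (M * (N + 1))) := by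
  have hne : {k : ℕ | ∃ cs, ChainWithExit s r cs ∧ cs.length = k}.Nonempty := by
    by_contra h
    rw [Set.not_nonempty_iff_eq_empty] at h
    rw [h] at hd₂
    simp at hd₂
    omega
  have hmem : d₂ ∈ {k : ℕ | ∃ cs, ChainWithExit s r cs ∧ cs.length = k} := by
    rw [hd₂]
    refine Nat.sSup_mem hne ⟨Nat.card (Set E), ?_⟩
    rintro k ⟨cs, h, rfl⟩
    exact length_le_of_pairwise h.1.2.2
  obtain ⟨cs, ⟨hcs, c₀, hc₀, hex⟩, hl⟩ := hmem
  rcases List.eq_nil_or_concat cs with rfl | ⟨ds, c, rfl⟩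
  · simp at hc₀
  rw [List.concat_eq_append] at hcs hl hc₀
  simp at hc₀
  subst hc₀
  have hcyc : IsCycle s r c := hcs.1 c (by simp)
  obtain ⟨e, he, hec⟩ := hex
  have h1 : LB s r (s e) (r e) (0 + 1) := LB_cycle (t := []) hcyc he hec ⟨rfl, rfl⟩ (LB_zero (r e))
  obtain ⟨d, u', _, _, hLB⟩ := LB_chain hsep he h1 ds hcs
  have := lower_core F (ε := 0) (c := []) (w := r e) rfl (fun N a h i hi => by
    simp [lvert_ne_zero] at h
    have : i = 0 := by simpa using hi
    exact this ▸ h) (by omega) hLB W hfd hgen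
  have hh : 2 * (0 + 1 + ds.length) + 0 = 2 * d₂ := by
    simp at hl; omega
  rwa [hh] at this

end Lower


section Upper
variable {V E : Type} {s r : E → V}

theorem nev_wk {y w : V} {c : List E} (hy : y ∈ NEV s r) (h : Wk s r y c w) :
    w ∈ NEV s r ∧ ∀ e ∈ c, e ∈ NEE s r := by
  induction c generalizing y with
  | nil => cases h; exact ⟨hy, by simp⟩
  | cons e c ih =>
    obtain ⟨rfl, h⟩ := h
    have he : e ∈ NEE s r := hy
    obtain ⟨h1, h2⟩ := ih (nee_r he) h
    refine ⟨h1, ?_⟩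
    intro f hf
    rcases List.mem_cons.1 hf with rfl | hf
    · exact he
    · exact h2 f hf

theorem nev_wk_unique (hsep : SeparatedCycles s r) {y w w' : V} {c d : List E}
    (hy : y ∈ NEV s r) (h : Wk s r y c w) (h' : Wk s r y d w') (hl : c.length = d.length) :
    c = d := by
  induction c generalizing y d with
  | nil => exact (List.length_eq_zero_iff.1 hl.symm).symm
  | cons e c ih =>
    cases d with
    | nil => simp at hl
    | cons f d =>
      obtain ⟨rfl, h⟩ := h
      obtain ⟨h1, h'⟩ := h'
      have he : e ∈ NEE s r := hy
      have hf : f ∈ NEE s r := by rw [NEE, Set.mem_ofPred_eq, h1]; exact hy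
      obtain rfl := hsep.s_inj (nee_cyc he) (nee_cyc hf) h1.symm
      rw [ih (nee_r he) h h' (by simpa using hl)]

open Classical in
/-- the walk of length `n` starting at `y` (used on a cycle without exit) -/
noncomputable def cyc (s r : E → V) (y : V) (n : ℕ) : List E :=
  if h : ∃ p w, Wk s r y p w ∧ p.length = n then h.choose else []

theorem eq_cyc (hsep : SeparatedCycles s r) {y w : V} {c : List E}
    (hy : y ∈ NEV s r) (h : Wk s r y c w) : c = cyc s r y c.length := by
  have hx : ∃ p w, Wk s r y p w ∧ p.length = c.length := ⟨c, w, h, rfl⟩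
  rw [cyc, dif_pos hx]
  obtain ⟨w', h1, h2⟩ := hx.choose_spec
  exact nev_wk_unique hsep hy h h1 h2.symm

theorem wk_decomp {u w : V} {p : List E} (h : Wk s r u p w) :
    ∃ p' c y, p = p' ++ c ∧ Wk s r u p' y ∧ Wk s r y c w ∧ (∀ e ∈ p', e ∉ NEE s r) ∧
      (c ≠ [] → y ∈ NEV s r) := by
  induction p generalizing u with
  | nil => exact ⟨[], [], u, rfl, rfl, h, by simp, by simp⟩
  | cons e p ih =>
    by_cases he : e ∈ NEE s r
    · refine ⟨[], e :: p, u, rfl, rfl, h, by simp, fun _ => ?_⟩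
      rw [← h.1]; exact he
    · obtain ⟨p', c, y, rfl, h1, h2, h3, h4⟩ := ih h.2
      refine ⟨e :: p', c, y, rfl, ⟨h.1, h1⟩, h2, ?_, h4⟩
      intro f hf
      rcases List.mem_cons.1 hf with rfl | hf
      · exact he
      · exact h3 f hf

variable (F : Type) [Field F]

/-- monomials `p v q*` -/
noncomputable def mon (s r : E → V) (p : List E) (v : V) (q : List E) :
    LeavittPathAlgebra F s r := lpath F s r p * lvert F s r v * lpathStar F s r q

theorem mon_lvert {u v : V} {q : List E} (hq : Wk s r u q v) (p : List E) :
    mon F s r p v q * lvert F s r u = mon F s r p v q := by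
  cases q with
  | nil => cases hq; simp [mon, lpathStar_nil, mul_assoc, lvert_mul_self]
  | cons e q =>
    obtain ⟨rfl, _⟩ := hq
    simp only [mon, lpathStar_cons, mul_assoc, lstar_lvert]

theorem mon_lvert_ne {u v w : V} {q : List E} (hq : Wk s r u q v) (p : List E) (h : u ≠ w) :
    mon F s r p v q * lvert F s r w = 0 := by
  rw [← mon_lvert F hq p, mul_assoc, lvert_mul_ne F s r h, mul_zero]

/-- the spanning space of monomials of bounded length -/
noncomputable def UU (s r : E → V) (k : ℕ) : Submodule F (LeavittPathAlgebra F s r) :=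
  Submodule.span F ({1} ∪ {x | ∃ u u' p v q, Wk s r u p v ∧ Wk s r u' q v ∧ p.length ≤ k ∧
    q.length ≤ k ∧ x = mon F s r p v q})

theorem mon_mem_UU {k : ℕ} {u u' v : V} {p q : List E} (h1 : Wk s r u p v) (h2 : Wk s r u' q v)
    (h3 : p.length ≤ k) (h4 : q.length ≤ k) : mon F s r p v q ∈ UU F s r k :=
  Submodule.subset_span (Or.inr ⟨u, u', p, v, q, h1, h2, h3, h4, rfl⟩)

/-- the generating space -/
noncomputable def GG (s r : E → V) : Submodule F (LeavittPathAlgebra F s r) :=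
  Submodule.span F ({1} ∪ Set.range (lvert F s r) ∪ Set.range (ledge F s r) ∪
    Set.range (lstar F s r))

theorem one_mem_GG : (1 : LeavittPathAlgebra F s r) ∈ GG F s r :=
  Submodule.subset_span (by simp)

theorem one_le_GG : (1 : Submodule F (LeavittPathAlgebra F s r)) ≤ GG F s r :=
  Submodule.one_le.2 (one_mem_GG F)

theorem GG_pow_mono {a b : ℕ} (h : a ≤ b) : GG F s r ^ a ≤ GG F s r ^ b :=
  pow_le_pow_right' (one_le_GG F) h

theorem UU_mul_GG (k : ℕ) : UU F s r k * GG F s r ≤ UU F s r (k + 1) := by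
  rw [UU, GG, Submodule.span_mul_span, Submodule.span_le]
  rintro _ ⟨x, hx, y, hy, rfl⟩
  dsimp only
  rcases hx with hx | ⟨u, u', p, v, q, h1, h2, h3, h4, rfl⟩
  · rw [Set.mem_singleton_iff] at hx
    subst hx
    rw [one_mul]
    rcases hy with ((hy | ⟨v, rfl⟩) | ⟨e, rfl⟩) | ⟨e, rfl⟩
    · exact Submodule.subset_span (Or.inl hy)
    · have : lvert F s r v = mon F s r [] v [] := by simp [mon, lpath_nil, lpathStar_nil]
      rw [this]
      exact mon_mem_UU F (u := v) (u' := v) rfl rfl (by simp) (by simp)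
    · have : ledge F s r e = mon F s r [e] (r e) [] := by
        simp [mon, lpath_nil, lpath_cons, lpathStar_nil, ledge_lvert]
      rw [this]
      exact mon_mem_UU F (u := s e) (u' := r e) ⟨rfl, rfl⟩ rfl (by simp) (by simp)
    · have : lstar F s r e = mon F s r [] (r e) [e] := by
        simp [mon, lpath_nil, lpathStar_cons, lpathStar_nil, lvert_lstar]
      rw [this]
      exact mon_mem_UU F (u := r e) (u' := s e) rfl ⟨rfl, rfl⟩ (by simp) (by simp)
  · rcases hy with ((hy | ⟨w, rfl⟩) | ⟨e, rfl⟩) | ⟨e, rfl⟩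
    · rw [Set.mem_singleton_iff] at hy
      subst hy
      rw [mul_one]
      exact mon_mem_UU F h1 h2 (by omega) (by omega)
    · by_cases huw : u' = w
      · subst huw
        rw [mon_lvert F h2]
        exact mon_mem_UU F h1 h2 (by omega) (by omega)
      · rw [mon_lvert_ne F h2 _ huw]
        exact Submodule.zero_mem _
    · by_cases hu : u' = s e
      · cases q with
        | nil =>
          obtain rfl : u' = v := h2
          have : mon F s r p u' [] * ledge F s r e = mon F s r (p ++ [e]) (r e) [] := by
            simp only [mon, lpathStar_nil, mul_one, lpath_append, lpath_cons, lpath_nil]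
            rw [hu, mul_assoc, lvert_ledge, mul_assoc, ledge_lvert]
          rw [this]
          exact mon_mem_UU F (u' := r e) (h1.append ⟨hu.symm, rfl⟩) rfl
            (by simpa using h3) (by simp)
        | cons f q =>
          by_cases hfe : f = e
          · subst hfe
            have : mon F s r p v (f :: q) * ledge F s r f = mon F s r p v q * lvert F s r (r f) := by
              simp only [mon, lpathStar_cons, mul_assoc, lstar_ledge]
            rw [this, mon_lvert F h2.2]
            simp at h4
            exact mon_mem_UU F h1 h2.2 (by omega) (by omega)
          · have : mon F s r p v (f :: q) * ledge F s r e = 0 := by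
              simp only [mon, lpathStar_cons, mul_assoc, lstar_ledge_ne F s r hfe, mul_zero]
            rw [this]
            exact Submodule.zero_mem _
      · rw [← lvert_ledge, ← mul_assoc, mon_lvert_ne F h2 _ hu, zero_mul]
        exact Submodule.zero_mem _
    · by_cases hu : u' = r e
      · have : mon F s r p v q * lstar F s r e = mon F s r p v (e :: q) := by
          simp only [mon, lpathStar_cons, mul_assoc]
        rw [this]
        subst hu
        exact mon_mem_UU F (u' := s e) h1 ⟨rfl, h2⟩ (by omega) (by simpa using h4)
      · rw [← lvert_lstar, ← mul_assoc, mon_lvert_ne F h2 _ hu, zero_mul]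
        exact Submodule.zero_mem _

theorem GG_pow_le (k : ℕ) : GG F s r ^ k ≤ UU F s r k := by
  induction k with
  | zero =>
    rw [pow_zero]
    exact Submodule.one_le.2 (Submodule.subset_span (by simp))
  | succ k ih =>
    rw [pow_succ]
    exact (mul_le_mul_left ih _).trans (UU_mul_GG F k)

theorem exists_GG_pow (x : LeavittPathAlgebra F s r) : ∃ k, x ∈ GG F s r ^ k := by
  obtain ⟨y, rfl⟩ := RingQuot.mkAlgHom_surjective F (LeavittRel F s r) x
  induction y using FreeAlgebra.induction with
  | grade0 a =>
    refine ⟨1, ?_⟩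
    rw [AlgHom.commutes, Algebra.algebraMap_eq_smul_one, pow_one]
    exact Submodule.smul_mem _ _ (one_mem_GG F)
  | grade1 g =>
    refine ⟨1, ?_⟩
    rw [pow_one]
    refine Submodule.subset_span ?_
    cases g with
    | vert v => exact Or.inl (Or.inl (Or.inr ⟨v, rfl⟩))
    | edge v => exact Or.inl (Or.inr ⟨v, rfl⟩)
    | star v => exact Or.inr ⟨v, rfl⟩
  | mul a b ha hb =>
    obtain ⟨k, hk⟩ := ha
    obtain ⟨l, hl⟩ := hb
    refine ⟨k + l, ?_⟩
    rw [map_mul, pow_add]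
    exact Submodule.mul_mem_mul hk hl
  | add a b ha hb =>
    obtain ⟨k, hk⟩ := ha
    obtain ⟨l, hl⟩ := hb
    refine ⟨k + l, ?_⟩
    rw [map_add]
    exact Submodule.add_mem _ (GG_pow_mono F (by omega) hk) (GG_pow_mono F (by omega) hl)

theorem exists_le_GG_pow (W : Submodule F (LeavittPathAlgebra F s r))
    (hfd : FiniteDimensional F W) : ∃ m, W ≤ GG F s r ^ m := by
  obtain ⟨S, hS⟩ := (Submodule.fg_iff_finiteDimensional W).2 hfd
  choose g hg using exists_GG_pow F (s := s) (r := r)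
  refine ⟨∑ x ∈ S, g x, ?_⟩
  rw [← hS, Submodule.span_le]
  intro x hx
  exact GG_pow_mono F (Finset.single_le_sum (f := g) (fun _ _ => Nat.zero_le _) hx) (hg x)

theorem powsSum_le_UU (W : Submodule F (LeavittPathAlgebra F s r))
    (hfd : FiniteDimensional F W) : ∃ m, ∀ n, powsSum F W n ≤ UU F s r (m * n) := by
  obtain ⟨m, hm⟩ := exists_le_GG_pow F W hfd
  refine ⟨m, fun n => ?_⟩
  refine (powsSum_le W fun i _ hi => ?_).trans (GG_pow_le F (m * n))
  refine (pow_le_pow_left' hm i).trans ?_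
  rw [← pow_mul]
  exact GG_pow_mono F (Nat.mul_le_mul_left m hi)

open Classical in
/-- the finite spanning set -/
noncomputable def TT [Fintype V] [Fintype E] (s r : E → V) (k : ℕ) :
    Finset (LeavittPathAlgebra F s r) :=
  {1} ∪ (Finset.univ ×ˢ (allPths s r Set.univ k ×ˢ allPths s r Set.univ k)).image
      (fun x => mon F s r x.2.1 x.1 x.2.2)
    ∪ ((Finset.univ ×ˢ (Finset.univ.filter (· ∈ NEV s r) ×ˢ Finset.range (k + 1))) ×ˢ
      (allPths s r (NEV s r) k ×ˢ allPths s r (NEV s r) k)).image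
      (fun x => mon F s r (x.2.1 ++ cyc s r x.1.2.1 x.1.2.2) x.1.1 x.2.2)
    ∪ ((Finset.univ ×ˢ (Finset.univ.filter (· ∈ NEV s r) ×ˢ Finset.range (k + 1))) ×ˢ
      (allPths s r (NEV s r) k ×ˢ allPths s r (NEV s r) k)).image
      (fun x => mon F s r x.2.1 x.1.1 (x.2.2 ++ cyc s r x.1.2.1 x.1.2.2))

theorem mon_cancel (hsep : SeparatedCycles s r) {e : E} (he : e ∈ NEE s r) (p q : List E) :
    mon F s r (p ++ [e]) (r e) (q ++ [e]) = mon F s r p (s e) q := by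
  have hu : ∀ f, s f = s e → f = e := by
    intro f hf
    have hf' : f ∈ NEE s r := by rw [NEE, Set.mem_ofPred_eq, hf]; exact he
    exact hsep.s_inj (nee_cyc hf') (nee_cyc he) hf
  have h1 := ledge_lstar_of_unique F s r hu
  simp only [mon, lpath_append, lpathStar_append, lpath_cons, lpathStar_cons, lpath_nil,
    lpathStar_nil, mul_one, one_mul]
  rw [mul_assoc (lpath F s r p), ledge_lvert, ← h1]
  simp only [mul_assoc]

theorem mon_mem_TT [Fintype V] [Fintype E] (hsep : SeparatedCycles s r) {k : ℕ} (n : ℕ)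
    {u u' v : V} {p q : List E} (hn : p.length = n) (h1 : Wk s r u p v) (h2 : Wk s r u' q v)
    (h3 : p.length ≤ k) (h4 : q.length ≤ k) :
    mon F s r p v q ∈ Submodule.span F (TT F s r k : Set (LeavittPathAlgebra F s r)) := by
  classical
  induction n generalizing p q v with
  | zero =>
    have hp : p = [] := List.length_eq_zero_iff.1 hn
    subst hp
    obtain rfl : u = v := h1
    obtain ⟨q', d, y', rfl, b1, b2, b3, b4⟩ := wk_decomp h2
    refine Submodule.subset_span ?_
    rw [List.length_append] at h4
    by_cases hd : d = []
    · subst hd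
      obtain rfl : y' = u := b2
      simp only [TT, Finset.coe_union, Set.mem_union, Finset.mem_coe]
      refine Or.inl (Or.inl (Or.inr (Finset.mem_image.2 ⟨(y', [], q'), ?_, by simp⟩)))
      simp only [Finset.mem_product, Finset.mem_univ, true_and]
      exact ⟨mem_allPths (v := y') (w := y') rfl (by simp) trivial (by simp),
        mem_allPths b1 b3 trivial (by omega)⟩
    · have hy := b4 hd
      obtain ⟨hv, _⟩ := nev_wk hy b2
      simp only [TT, Finset.coe_union, Set.mem_union, Finset.mem_coe]
      refine Or.inr (Finset.mem_image.2 ⟨((u, y', d.length), [], q'), ?_, ?_⟩)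
      · simp only [Finset.mem_product, Finset.mem_univ, true_and, Finset.mem_filter,
          Finset.mem_range]
        exact ⟨⟨hy, by omega⟩, mem_allPths (v := u) (w := u) rfl (by simp) hv (by simp),
          mem_allPths b1 b3 hy (by omega)⟩
      · dsimp only
        rw [← eq_cyc hsep hy b2]
  | succ n ih =>
    obtain ⟨p', c, y, rfl, a1, a2, a3, a4⟩ := wk_decomp h1
    obtain ⟨q', d, y', rfl, b1, b2, b3, b4⟩ := wk_decomp h2
    rw [List.length_append] at h3 h4 hn
    by_cases hv : v ∈ NEV s r
    · have hy : y ∈ NEV s r := by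
        by_cases hc : c = []
        · subst hc; obtain rfl : y = v := a2; exact hv
        · exact a4 hc
      have hy' : y' ∈ NEV s r := by
        by_cases hc : d = []
        · subst hc; obtain rfl : y' = v := b2; exact hv
        · exact b4 hc
      have hp' := mem_allPths (N := k) a1 a3 hy (by omega)
      have hq' := mem_allPths (N := k) b1 b3 hy' (by omega)
      rcases List.eq_nil_or_concat d with rfl | ⟨d', e', rfl⟩
      · refine Submodule.subset_span ?_
        simp only [TT, Finset.coe_union, Set.mem_union, Finset.mem_coe]
        refine Or.inl (Or.inr (Finset.mem_image.2 ⟨((v, y, c.length), p', q'), ?_, ?_⟩))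
        · simp only [Finset.mem_product, Finset.mem_univ, true_and, Finset.mem_filter,
            Finset.mem_range]
          exact ⟨⟨hy, by omega⟩, hp', hq'⟩
        · dsimp only
          rw [← eq_cyc hsep hy a2, List.append_nil]
      · rcases List.eq_nil_or_concat c with rfl | ⟨c', e, rfl⟩
        · refine Submodule.subset_span ?_
          simp only [TT, Finset.coe_union, Set.mem_union, Finset.mem_coe]
          refine Or.inr (Finset.mem_image.2 ⟨((v, y', (d'.concat e').length), p', q'), ?_, ?_⟩)
          · simp only [Finset.mem_product, Finset.mem_univ, true_and, Finset.mem_filter,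
              Finset.mem_range]
            exact ⟨⟨hy', by omega⟩, hp', hq'⟩
          · dsimp only
            rw [← eq_cyc hsep hy' b2, List.append_nil]
        · rw [List.concat_eq_append] at *
          have he := (nev_wk hy a2).2 e (by simp)
          have he' := (nev_wk hy' b2).2 e' (by simp)
          obtain ⟨x, x1, x2⟩ := a2.split
          obtain ⟨x', x1', x2'⟩ := b2.split
          obtain ⟨rfl, rfl⟩ := x2
          obtain ⟨rfl, hre⟩ := x2'
          have hre : r e' = r e := hre
          obtain rfl := hsep.r_inj (nee_cyc he') (nee_cyc he) hre
          simp only [List.concat_eq_append]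
          rw [← List.append_assoc p', ← List.append_assoc q', mon_cancel F hsep he]
          simp only [List.length_append, List.length_singleton] at h3 h4 hn
          refine ih ?_ (a1.append x1) (b1.append x1') ?_ ?_ <;> rw [List.length_append] <;> omega
    · have hc : c = [] := by
        by_contra hc
        exact hv (nev_wk (a4 hc) a2).1
      have hd : d = [] := by
        by_contra hc
        exact hv (nev_wk (b4 hc) b2).1
      subst hc hd
      refine Submodule.subset_span ?_
      simp only [TT, Finset.coe_union, Set.mem_union, Finset.mem_coe]
      refine Or.inl (Or.inl (Or.inr (Finset.mem_image.2 ⟨(v, p', q'), ?_, by simp⟩)))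
      simp only [Finset.mem_product, Finset.mem_univ, true_and]
      exact ⟨mem_allPths a1 a3 trivial (by omega), mem_allPths b1 b3 trivial (by omega)⟩

theorem UU_le_TT [Fintype V] [Fintype E] (hsep : SeparatedCycles s r) (k : ℕ) :
    UU F s r k ≤ Submodule.span F (TT F s r k : Set (LeavittPathAlgebra F s r)) := by
  rw [UU, Submodule.span_le]
  rintro x (hx | ⟨u, u', p, v, q, h1, h2, h3, h4, rfl⟩)
  · refine Submodule.subset_span ?_
    simp only [TT, Finset.coe_union, Set.mem_union, Finset.mem_coe]
    exact Or.inl (Or.inl (Or.inl (by simpa using hx)))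
  · exact mon_mem_TT F hsep _ rfl h1 h2 h3 h4

theorem card_TT_le [Fintype V] [Fintype E] (hsep : SeparatedCycles s r) (d₁ d₂ : ℕ)
    (hd₁ : d₁ = sSup {k : ℕ | ∃ cs, IsChainOfCycles s r cs ∧ cs.length = k})
    (hd₂ : d₂ = sSup {k : ℕ | ∃ cs, ChainWithExit s r cs ∧ cs.length = k}) :
    ∃ C, ∀ k, (TT F s r k).card ≤ C * (k + 1) ^ (max (2 * d₁ - 1) (2 * d₂)) := by
  classical
  obtain ⟨C₂, hC₂⟩ := card_allPths_le hsep Set.univ d₂ (fun v => pot_univ_le v d₂ hd₂)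
  obtain ⟨C₁, hC₁⟩ := card_allPths_le hsep (NEV s r) (d₁ - 1) (fun v => by
    by_cases h : ∃ b ∈ NEV s r, Reach s r v b
    · obtain ⟨b, hb, hr⟩ := h
      have := pot_nev_le d₁ hb hr hd₁
      omega
    · have : {k | ∃ cs, Ch s r (NEV s r) v cs ∧ cs.length = k} = ∅ := by
        rw [Set.eq_empty_iff_forall_notMem]
        rintro k ⟨cs, hcs, _⟩
        cases cs with
        | nil => exact h hcs
        | cons c cs =>
          obtain ⟨u, hu, b, hb, hr⟩ := hcs.last_reach
            (List.getLast?_eq_some_getLast (List.cons_ne_nil c cs))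
          obtain ⟨u', hu', hr'⟩ := hcs.reach_mem (List.getLast_mem (List.cons_ne_nil c cs))
          have hcy := (hcs.all _ (List.getLast_mem (List.cons_ne_nil c cs))).1
          exact h ⟨b, hb, hr'.trans ((hcy.reach hu' hu).trans hr)⟩
      rw [pot, this]
      simp)
  set D := max (2 * d₁ - 1) (2 * d₂) with hD
  set n := Fintype.card V with hn
  refine ⟨1 + n * C₂ ^ 2 + 2 * (n * n * C₁ ^ 2), fun k => ?_⟩
  set Y := Finset.univ.filter (· ∈ NEV s r) with hY
  have hA : (allPths s r Set.univ k).card * (allPths s r Set.univ k).card ≤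
      C₂ ^ 2 * (k + 1) ^ D := by
    calc _ ≤ (C₂ * (k + 1) ^ d₂) * (C₂ * (k + 1) ^ d₂) := Nat.mul_le_mul (hC₂ k) (hC₂ k)
      _ = C₂ ^ 2 * (k + 1) ^ (2 * d₂) := by ring
      _ ≤ _ := by gcongr <;> omega
  have hB : (n * (Y.card * (k + 1))) *
      ((allPths s r (NEV s r) k).card * (allPths s r (NEV s r) k).card) ≤
      n * n * C₁ ^ 2 * (k + 1) ^ D := by
    by_cases hy : Y.card = 0
    · rw [hy]; simp
    · obtain ⟨y, hy⟩ := Finset.card_pos.1 (Nat.pos_of_ne_zero hy)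
      have hy : y ∈ NEV s r := by simpa [hY] using hy
      have h1 := pot_nev_le d₁ hy (Reach.refl y) hd₁
      have hYn : Y.card ≤ n := Finset.card_le_univ _
      calc _ ≤ (n * (n * (k + 1))) * ((C₁ * (k + 1) ^ (d₁ - 1)) * (C₁ * (k + 1) ^ (d₁ - 1))) := by
            gcongr
            · exact hC₁ k
            · exact hC₁ k
        _ = n * n * C₁ ^ 2 * (k + 1) ^ (2 * (d₁ - 1) + 1) := by ring
        _ ≤ _ := by gcongr <;> omega
  have h1 : 1 ≤ (k + 1) ^ D := Nat.one_le_pow _ _ (by omega)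
  have hcard : (TT F s r k).card ≤ 1 + n * ((allPths s r Set.univ k).card *
      (allPths s r Set.univ k).card) + (n * (Y.card * (k + 1))) *
      ((allPths s r (NEV s r) k).card * (allPths s r (NEV s r) k).card) +
      (n * (Y.card * (k + 1))) *
      ((allPths s r (NEV s r) k).card * (allPths s r (NEV s r) k).card) := by
    rw [TT]
    refine (Finset.card_union_le _ _).trans (Nat.add_le_add ((Finset.card_union_le _ _).trans
      (Nat.add_le_add ((Finset.card_union_le _ _).trans (Nat.add_le_add (by simp) ?_)) ?_)) ?_)
    all_goals
      refine Finset.card_image_le.trans (le_of_eq ?_)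
      simp only [Finset.card_product, Finset.card_univ, Finset.card_range, hn, hY]
  calc _ ≤ _ := hcard
    _ ≤ (k + 1) ^ D + n * (C₂ ^ 2 * (k + 1) ^ D) + n * n * C₁ ^ 2 * (k + 1) ^ D +
        n * n * C₁ ^ 2 * (k + 1) ^ D := by gcongr
    _ = _ := by ring

theorem upper [Fintype V] [Fintype E] (hsep : SeparatedCycles s r) (d₁ d₂ : ℕ)
    (hd₁ : d₁ = sSup {k : ℕ | ∃ cs, IsChainOfCycles s r cs ∧ cs.length = k})
    (hd₂ : d₂ = sSup {k : ℕ | ∃ cs, ChainWithExit s r cs ∧ cs.length = k})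
    (W : Submodule F (LeavittPathAlgebra F s r)) (hfd : FiniteDimensional F W) :
    ∃ C, ∀ n, Module.finrank F (powsSum F W n) ≤ C * (n + 1) ^ (max (2 * d₁ - 1) (2 * d₂)) := by
  obtain ⟨C, hC⟩ := card_TT_le F hsep d₁ d₂ hd₁ hd₂
  obtain ⟨m, hm⟩ := powsSum_le_UU F W hfd
  refine ⟨C * (m + 1) ^ (max (2 * d₁ - 1) (2 * d₂)), fun n => ?_⟩
  have h1 := Submodule.finrank_mono ((hm n).trans (UU_le_TT F hsep (m * n)))
  refine h1.trans ((finrank_span_finset_le_card _).trans ((hC _).trans ?_))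
  rw [mul_assoc, ← mul_pow]
  gcongr
  nlinarith

end Upper

section Analysis

theorem tendsto_of_bounds (a : ℕ → ℕ) (ha : Monotone a) (D C M : ℕ) (hpos : ∀ᶠ n in Filter.atTop, 0 < a n)
    (hup : ∀ n, a n ≤ C * (n + 1) ^ D)
    (hlow : D = 0 ∨ ∀ N, (N + 1) ^ D ≤ a (M * (N + 1))) :
    Filter.Tendsto (fun n : ℕ => Real.log (a n) / Real.log n) Filter.atTop (nhds (D : ℝ)) := by
  have hlog : Filter.Tendsto (fun n : ℕ => Real.log (n : ℝ)) Filter.atTop Filter.atTop :=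
    Real.tendsto_log_atTop.comp tendsto_natCast_atTop_atTop
  have hC : 0 < C := by
    obtain ⟨n, hn⟩ := hpos.exists
    by_contra h
    have : C = 0 := by omega
    have := hup n
    simp_all
  have hinv : ∀ c : ℝ, Filter.Tendsto (fun n : ℕ => (D : ℝ) + c / Real.log n) Filter.atTop
      (nhds (D : ℝ)) := by
    intro c
    have := (hlog.const_div_atTop c).const_add (D : ℝ)
    simpa using this
  have hlogpos : ∀ᶠ n : ℕ in Filter.atTop, 0 < Real.log (n : ℝ) :=
    hlog.eventually_gt_atTop 0
  have hupper : ∀ᶠ n : ℕ in Filter.atTop, Real.log (a n) / Real.log n ≤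
      (D : ℝ) + (Real.log (C * 2 ^ D)) / Real.log n := by
    filter_upwards [hlogpos, hpos, Filter.eventually_ge_atTop 1] with n h1 h2 h3
    have h4 : (a n : ℝ) ≤ C * 2 ^ D * (n : ℝ) ^ D := by
      have : a n ≤ C * (2 ^ D * n ^ D) := by
        rw [← mul_pow]
        refine (hup n).trans ?_
        gcongr
        omega
      calc (a n : ℝ) ≤ ((C * (2 ^ D * n ^ D) : ℕ) : ℝ) := by exact_mod_cast this
        _ = _ := by push_cast; ring
    have hn : (0 : ℝ) < n := by exact_mod_cast h3
    have hC' : (0 : ℝ) < C := by exact_mod_cast hC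
    have h5 := Real.log_le_log (by exact_mod_cast h2) h4
    rw [Real.log_mul (by positivity) (by positivity), Real.log_pow] at h5
    rw [div_le_iff₀ h1, add_mul, div_mul_cancel₀ _ h1.ne']
    linarith
  rcases hlow with h0 | hlow
  · subst h0
    refine tendsto_of_tendsto_of_tendsto_of_le_of_le' tendsto_const_nhds (hinv _) ?_ hupper
    filter_upwards [hlogpos] with n h1
    rw [Nat.cast_zero]
    exact div_nonneg (Real.log_natCast_nonneg _) h1.le
  · refine tendsto_of_tendsto_of_tendsto_of_le_of_le' (hinv (-(D * Real.log (2 * (M + 1)))))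
      (hinv _) ?_ hupper
    filter_upwards [hlogpos, hpos, Filter.eventually_ge_atTop (M + 1)] with n h1 h2 h3
    obtain ⟨N, hN⟩ : ∃ N, n / (M + 1) = N + 1 :=
      ⟨n / (M + 1) - 1, by have := Nat.div_pos h3 (by omega); omega⟩
    have h4 : (M + 1) * (N + 1) ≤ n := by rw [← hN]; exact Nat.mul_div_le _ _
    have h5 : n < (M + 1) * (N + 1 + 1) := by
      rw [← hN]; exact Nat.lt_mul_div_succ n (by omega)
    have h6 : (N + 1) ^ D ≤ a n := (hlow N).trans (ha (by nlinarith))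
    have h7 : (n : ℝ) ≤ 2 * (M + 1) * (N + 1) := by
      have : n ≤ 2 * (M + 1) * (N + 1) := by nlinarith
      exact_mod_cast this
    have hn : (0 : ℝ) < n := by
      have : 0 < n := by omega
      exact_mod_cast this
    have h8 := Real.log_le_log hn h7
    rw [Real.log_mul (by positivity) (by positivity)] at h8
    have h9 : Real.log ((N + 1 : ℝ) ^ D) ≤ Real.log (a n) :=
      Real.log_le_log (by positivity) (by exact_mod_cast h6)
    rw [Real.log_pow] at h9
    rw [le_div_iff₀ h1, add_mul, div_mul_cancel₀ _ h1.ne']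
    have : (D : ℝ) * Real.log n ≤ D * (Real.log (2 * (M + 1)) + Real.log (N + 1)) := by gcongr
    linarith

end Analysis


theorem leavitt_one_ne_zero {V E : Type} (F : Type) [Field F] (s r : E → V) :
    (1 : LeavittPathAlgebra F s r) ≠ 0 := by
  intro h
  let φ : LeavittPathAlgebra F s r →ₐ[F] F :=
    RingQuot.liftAlgHom F ⟨FreeAlgebra.lift F (fun _ => (0 : F)), by
      intro x y hxy
      induction hxy <;> simp [gvert, gedge, gstar]⟩
  have h2 := congrArg φ h
  rw [map_one, map_zero] at h2
  exact one_ne_zero h2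

section LeavittSetup

variable {V E : Type}

variable (F : Type) [Field F]

variable (s r : E → V)

/-- Theorem 2(2) of the paper.  Let `Γ` be a finite graph in which
distinct cycles have no common vertex, `d₁` the maximal length of a chain of cycles,
and `d₂` the maximal length of a chain of cycles with an exit.  Then
`GKdim L(Γ) = max (2 d₁ - 1) (2 d₂)`: for every finite-dimensional generating
subspace `W`, `limsup log dim (W + ⋯ + Wⁿ) / log n = max (2 d₁ - 1) (2 d₂)`. -/
theorem gelfandKirillov_dimension_of_leavitt
    [Fintype V] [Fintype E]
    (hsep : SeparatedCycles s r) (d₁ d₂ : ℕ)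
    (hd₁ : d₁ = sSup {k : ℕ | ∃ cs, IsChainOfCycles s r cs ∧ cs.length = k})
    (hd₂ : d₂ = sSup {k : ℕ | ∃ cs, ChainWithExit s r cs ∧ cs.length = k})
    (W : Submodule F (LeavittPathAlgebra F s r)) (hfd : FiniteDimensional F W)
    (hgen : ∀ x : LeavittPathAlgebra F s r, ∃ n : ℕ, x ∈ powsSum F W n) :
    Filter.limsup
        (fun n : ℕ =>
          Real.log (Module.finrank F (powsSum F W n)) / Real.log n)
        Filter.atTop
      = (max (2 * d₁ - 1) (2 * d₂) : ℕ) := by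
  classical
  have hfin := powsSum_finite W hfd
  obtain ⟨C, hC⟩ := upper F hsep d₁ d₂ hd₁ hd₂ W hfd
  have hlow : ∃ M : ℕ, max (2 * d₁ - 1) (2 * d₂) = 0 ∨ ∀ N : ℕ,
      (N + 1) ^ (max (2 * d₁ - 1) (2 * d₂)) ≤ Module.finrank F (powsSum F W (M * (N + 1))) := by
    by_cases h0 : max (2 * d₁ - 1) (2 * d₂) = 0
    · exact ⟨0, Or.inl h0⟩
    rcases le_total (2 * d₁ - 1) (2 * d₂) with h | h
    · rw [max_eq_right h] at h0 ⊢
      obtain ⟨M, hM⟩ := lower_two F hsep d₂ (by omega) hd₂ W hfd hgen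
      exact ⟨M, Or.inr hM⟩
    · rw [max_eq_left h] at h0 ⊢
      obtain ⟨M, hM⟩ := lower_one F hsep d₁ (by omega) hd₁ W hfd hgen
      exact ⟨M, Or.inr hM⟩
  obtain ⟨M, hM⟩ := hlow
  refine (tendsto_of_bounds (fun n => Module.finrank F (powsSum F W n)) ?_ _ C M ?_ hC hM).limsup_eq
  · intro m n hmn
    exact Submodule.finrank_mono (powsSum_mono W hmn)
  · have hone := leavitt_one_ne_zero F s r
    obtain ⟨n₀, hn₀⟩ := hgen 1
    filter_upwards [Filter.eventually_ge_atTop n₀] with n hn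
    have hmem := powsSum_mono W hn hn₀
    have : Nontrivial (powsSum F W n) := ⟨⟨1, hmem⟩, 0, fun h => hone (congrArg Subtype.val h)⟩
    have := hfin n
    exact Module.finrank_pos (R := F) (M := powsSum F W n)

end LeavittSetup
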